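/- arXiv:2601.15700 — 2 statements merged into one kernel-verified Lean document; each statement's English description precedes it below -/
import Mathlib

section
/- For every nonnegative integer a and every integer r, the counting function X ↦ #{D ∈ ℤ : D > 0, D ≡ r (mod 2^a), and F(D) < X} satisfies #{...}/X → C/2^a as X → ∞, where C = ∏_{p odd prime} (1 − 1/p + 1/(p + (−2/p))) is the value of the (convergent) product over all odd primes. -/
/-- The Legendre symbol (−2/p) for a prime p (0 at p = 2, junk value 0 at non-primes). -/
noncomputable def leg (p : ℕ) : ℤ :=
  if h : p.Prime then @legendreSym p ⟨h⟩ (-2) else 0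

/-- F(D) = D · ∏_{p odd prime, p ∣ D} (1 + (−2/p)/p). -/
noncomputable def F (D : ℕ) : ℝ :=
  (D : ℝ) * ∏ p ∈ D.primeFactors.filter (fun p => p ≠ 2), (1 + (leg p : ℝ) / (p : ℝ))

/-- C = ∏_{p odd prime} (1 − 1/p + 1/(p + (−2/p))). -/
noncomputable def Cconst : ℝ :=
  ∏' p : {p : ℕ // p.Prime ∧ p ≠ 2},
    (1 - 1 / (p.1 : ℝ) + 1 / ((p.1 : ℝ) + (leg p.1 : ℝ)))

open Filter Topology Finset

/-- Positive integers `D ≡ r (mod m)` for which `D` times the product of the weights `w p` over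
the `p ∈ S` dividing `D` is less than `X`. -/
def weightedSet (w : ℕ → ℝ) (S : Finset ℕ) (m : ℕ) (r : ℤ) (X : ℝ) : Set ℕ :=
  {D | 0 < D ∧ (D : ℤ) ≡ r [ZMOD (m : ℤ)] ∧ (D : ℝ) * ∏ p ∈ S with p ∣ D, w p < X}

lemma weightedSet_finite {w : ℕ → ℝ} (hw : ∀ p, 0 < w p) (S : Finset ℕ) (m : ℕ) (r : ℤ) (X : ℝ) :
    (weightedSet w S m r X).Finite := by
  set c := ∏ p ∈ S, min 1 (w p) with hc
  have hc0 : 0 < c := Finset.prod_pos fun p _ => lt_min one_pos (hw p)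
  refine (Set.finite_Iic ⌊X / c⌋₊).subset fun D hD => ?_
  obtain ⟨hD0, -, hX⟩ := hD
  have hle : c ≤ ∏ p ∈ S with p ∣ D, w p := by
    rw [Finset.prod_filter]
    refine Finset.prod_le_prod (fun p _ => (lt_min one_pos (hw p)).le) fun p _ => ?_
    split_ifs
    · exact min_le_right _ _
    · exact min_le_left _ _
  refine Nat.le_floor ((le_div_iff₀ hc0).2 (le_trans ?_ hX.le))
  gcongr

lemma abs_ncard_modEq_sub_le {m : ℕ} (hm : 0 < m) (r : ℤ) {X : ℝ} (hX : 1 ≤ X) :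
    |(({D : ℕ | 0 < D ∧ (D : ℤ) ≡ r [ZMOD (m : ℤ)] ∧ (D : ℝ) < X}.ncard : ℝ)) - X / m| ≤ 2 := by
  have hcard : {D : ℕ | 0 < D ∧ (D : ℤ) ≡ r [ZMOD (m : ℤ)] ∧ (D : ℝ) < X}.ncard
      = #{x ∈ Ico (1 : ℤ) ⌈X⌉ | x ≡ r [ZMOD (m : ℤ)]} := by
    rw [← Set.ncard_coe_finset, ← Set.ncard_image_of_injective _ (Nat.cast_injective (R := ℤ))]
    congr 1
    ext x
    simp only [Set.mem_image, Set.mem_ofPred_eq, coe_filter, Finset.mem_Ico, Int.lt_ceil]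
    constructor
    · rintro ⟨D, ⟨h0, h1, h2⟩, rfl⟩
      exact ⟨⟨by exact_mod_cast h0, by exact_mod_cast h2⟩, h1⟩
    · rintro ⟨⟨h0, h2⟩, h1⟩
      lift x to ℕ using by omega
      exact ⟨x, ⟨by omega, h1, by exact_mod_cast h2⟩, rfl⟩
  have hm' : (0 : ℤ) < m := by exact_mod_cast hm
  have hb : (1 : ℤ) ≤ ⌈X⌉ := Int.one_le_ceil_iff.2 (by linarith)
  have key := Int.Ico_filter_modEq_card 1 ⌈X⌉ hm' r
  have hmQ : (0 : ℚ) < ((m : ℤ) : ℚ) := by exact_mod_cast hm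
  rw [max_eq_left (sub_nonneg.2 (Int.ceil_mono (by gcongr)))] at key
  rw [hcard]
  set u := ((⌈X⌉ : ℤ) - (r : ℚ)) / ((m : ℤ) : ℚ) with hu
  set v := (((1 : ℤ) : ℚ) - (r : ℚ)) / ((m : ℤ) : ℚ) with hv
  have e1 : u - v = ((⌈X⌉ : ℚ) - 1) / m := by
    rw [hu, hv]; push_cast; ring
  have hm1 : (1 : ℝ) ≤ m := by exact_mod_cast hm
  have u1 : (u : ℝ) ≤ ⌈u⌉ := by exact_mod_cast Int.le_ceil u
  have u2 : (⌈u⌉ : ℝ) < u + 1 := by exact_mod_cast Int.ceil_lt_add_one u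
  have v1 : (v : ℝ) ≤ ⌈v⌉ := by exact_mod_cast Int.le_ceil v
  have v2 : (⌈v⌉ : ℝ) < v + 1 := by exact_mod_cast Int.ceil_lt_add_one v
  have e2 : (u : ℝ) - v = ((⌈X⌉ : ℝ) - 1) / m := by exact_mod_cast congrArg (Rat.cast (K := ℝ)) e1
  have key' : ((#{x ∈ Ico (1 : ℤ) ⌈X⌉ | x ≡ r [ZMOD (m : ℤ)]} : ℕ) : ℝ) = ⌈u⌉ - ⌈v⌉ := by
    exact_mod_cast congrArg (Int.cast (R := ℝ)) key
  have e3 : |((⌈X⌉ : ℝ) - 1) / m - X / m| ≤ 1 := by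
    rw [← sub_div, abs_div, abs_of_pos (by linarith : (0 : ℝ) < m)]
    refine div_le_one_of_le₀ (le_trans (abs_le.2 ⟨?_, ?_⟩) hm1) (by linarith)
    · linarith [Int.le_ceil X]
    · linarith [Int.ceil_lt_add_one X]
  rw [key']
  rw [abs_le] at e3 ⊢
  constructor <;> linarith [e3.1, e3.2]

lemma tendsto_ncard_modEq {m : ℕ} (hm : 0 < m) (r : ℤ) :
    Tendsto (fun X : ℝ =>
      ({D : ℕ | 0 < D ∧ (D : ℤ) ≡ r [ZMOD (m : ℤ)] ∧ (D : ℝ) < X}.ncard : ℝ) / X)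
      atTop (𝓝 (1 / m)) := by
  rw [tendsto_iff_norm_sub_tendsto_zero]
  have h2 : Tendsto (fun X : ℝ => 2 / X) atTop (𝓝 0) := tendsto_const_nhds.div_atTop tendsto_id
  refine tendsto_of_tendsto_of_tendsto_of_le_of_le' tendsto_const_nhds h2
    (Eventually.of_forall fun X => norm_nonneg _) ?_
  filter_upwards [eventually_ge_atTop 1] with X hX
  have hX0 : 0 < X := by linarith
  have := abs_ncard_modEq_sub_le hm r hX
  rw [Real.norm_eq_abs]
  refine le_trans (le_of_eq ?_) (div_le_div_of_nonneg_right this hX0.le)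
  rw [← abs_of_pos hX0, ← abs_div, abs_of_pos hX0, sub_div, div_right_comm, div_self hX0.ne']

lemma tendsto_ncard_weightedSet {w : ℕ → ℝ} (hw : ∀ p, 0 < w p) (S : Finset ℕ)
    (hS : ∀ p ∈ S, p.Prime) {m : ℕ} (hm : 0 < m) (hcop : ∀ p ∈ S, m.Coprime p) (r : ℤ) :
    Tendsto (fun X : ℝ => ((weightedSet w S m r X).ncard : ℝ) / X) atTop
      (𝓝 ((∏ p ∈ S, (1 - 1 / (p : ℝ) + 1 / (p * w p))) / m)) := by
  induction S using Finset.induction_on generalizing m r with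
  | empty => simpa [weightedSet] using tendsto_ncard_modEq hm r
  | insert q S hq ih =>
    have hqp : q.Prime := hS q (mem_insert_self _ _)
    have hmq : m.Coprime q := hcop q (mem_insert_self _ _)
    have hS' : ∀ p ∈ S, p.Prime := fun p hp => hS p (mem_insert_of_mem hp)
    obtain ⟨t, ht⟩ : ∃ t : ℤ, ∀ D : ℤ, D ≡ t [ZMOD ((m * q : ℕ) : ℤ)] ↔
        D ≡ r [ZMOD (m : ℤ)] ∧ (q : ℤ) ∣ D := by
      have hcop' : IsCoprime (m : ℤ) (q : ℤ) := Nat.isCoprime_iff_coprime.2 hmq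
      obtain ⟨x, y, hxy⟩ := hcop'
      have hmod : ∀ D t : ℤ, D ≡ t [ZMOD ((m * q : ℕ) : ℤ)] ↔
          D ≡ t [ZMOD (m : ℤ)] ∧ D ≡ t [ZMOD (q : ℤ)] := fun D t => by
        rw [Nat.cast_mul]
        exact (Int.modEq_and_modEq_iff_modEq_mul (by simpa using hmq)).symm
      refine ⟨r * (y * q), fun D => ?_⟩
      have h1 : r * (y * q) ≡ r [ZMOD (m : ℤ)] := by
        refine (Int.modEq_iff_dvd.2 ⟨r * x, ?_⟩)
        linear_combination (-r) * hxy
      have h2 : r * (y * q) ≡ 0 [ZMOD (q : ℤ)] :=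
        Int.modEq_zero_iff_dvd.2 ⟨r * y, by ring⟩
      rw [hmod, ← Int.modEq_zero_iff_dvd]
      exact ⟨fun h => ⟨h.1.trans h1, h.2.trans h2⟩, fun h => ⟨h.1.trans h1.symm, h.2.trans h2.symm⟩⟩
    have hcopS : ∀ p ∈ S, m.Coprime p := fun p hp => hcop p (mem_insert_of_mem hp)
    have hcopS' : ∀ p ∈ S, (m * q).Coprime p := fun p hp =>
      (hcopS p hp).mul_left ((Nat.coprime_primes hqp (hS' p hp)).2 (by rintro rfl; exact hq hp))
    have hset : ∀ X, weightedSet w (insert q S) m r X =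
        weightedSet w S (m * q) t (X / w q) ∪
          (weightedSet w S m r X \ weightedSet w S (m * q) t X) := fun X => by
      ext D
      simp only [weightedSet, Set.mem_union, Set.mem_sdiff, Set.mem_ofPred_eq, ht, Int.natCast_dvd_natCast,
        filter_insert]
      by_cases hqD : q ∣ D
      · rw [if_pos hqD, prod_insert (by simp [hq]), lt_div_iff₀ (hw q)]
        have : (D : ℝ) * (w q * ∏ p ∈ S with p ∣ D, w p) =
          D * (∏ p ∈ S with p ∣ D, w p) * w q := by ring
        rw [this]
        tauto
      · rw [if_neg hqD]
        tauto
    have hsub : ∀ X, weightedSet w S (m * q) t X ⊆ weightedSet w S m r X := fun X D hD =>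
      ⟨hD.1, ((ht D).1 hD.2.1).1, hD.2.2⟩
    have hcard : ∀ X, ((weightedSet w (insert q S) m r X).ncard : ℝ) =
        (weightedSet w S (m * q) t (X / w q)).ncard +
          ((weightedSet w S m r X).ncard - (weightedSet w S (m * q) t X).ncard) := fun X => by
      have hdis : Disjoint (weightedSet w S (m * q) t (X / w q))
          (weightedSet w S m r X \ weightedSet w S (m * q) t X) := by
        rw [Set.disjoint_left]
        rintro D hD ⟨h1, h2⟩
        exact h2 ⟨hD.1, hD.2.1, h1.2.2⟩
      rw [hset, Set.ncard_union_eq hdis (weightedSet_finite hw _ _ _ _)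
        ((weightedSet_finite hw _ _ _ _).subset Set.sdiff_subset), Nat.cast_add]
      rw [← Set.ncard_sdiff_add_ncard_of_subset (hsub X) (weightedSet_finite hw _ _ _ _)]
      push_cast
      ring
    have hmq0 : 0 < m * q := Nat.mul_pos hm hqp.pos
    have t1 := ((ih hS' hmq0 hcopS' t).comp (tendsto_id.atTop_div_const (hw q))).div_const (w q)
    have t2 := (ih hS' hm hcopS r).sub (ih hS' hmq0 hcopS' t)
    refine ((t1.add t2).congr' ?_).trans (le_of_eq ?_)
    · filter_upwards [eventually_gt_atTop 0] with X hX
      rw [hcard]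
      have := (hw q).ne'
      simp only [Function.comp, id]
      field_simp
    · rw [prod_insert hq]
      have := (hw q).ne'
      have : (q : ℝ) ≠ 0 := by exact_mod_cast hqp.ne_zero
      have : (m : ℝ) ≠ 0 := by exact_mod_cast hm.ne'
      congr 1
      push_cast
      field_simp
      ring
lemma sum_dvd_inv_sq_le {l M : ℕ} (hl : 0 < l) (hM : 0 < M) (N : ℕ) :
    ∑ D ∈ Ioc M N with l ∣ D, ((D : ℝ) ^ 2)⁻¹ ≤ 2 / (l * M) := by
  have hsub : (Ioc M N).filter (l ∣ ·) ⊆ (Ioo (M / l) (N / l + 1)).image (l * ·) := by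
    intro D hD
    obtain ⟨hD1, k, rfl⟩ := Finset.mem_filter.1 hD
    rw [Finset.mem_Ioc] at hD1
    refine mem_image.2 ⟨k, Finset.mem_Ioo.2 ⟨?_, ?_⟩, rfl⟩
    · exact Nat.div_lt_of_lt_mul hD1.1
    · exact Nat.lt_succ_of_le ((Nat.le_div_iff_mul_le hl).2 (by linarith [hD1.2]))
  have hlR : (0 : ℝ) < l := by exact_mod_cast hl
  have hMR : (0 : ℝ) < M := by exact_mod_cast hM
  calc ∑ D ∈ Ioc M N with l ∣ D, ((D : ℝ) ^ 2)⁻¹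
      ≤ ∑ D ∈ (Ioo (M / l) (N / l + 1)).image (l * ·), ((D : ℝ) ^ 2)⁻¹ :=
        sum_le_sum_of_subset_of_nonneg hsub fun _ _ _ => by positivity
    _ = ((l : ℝ) ^ 2)⁻¹ * ∑ k ∈ Ioo (M / l) (N / l + 1), ((k : ℝ) ^ 2)⁻¹ := by
        rw [sum_image fun a _ b _ h => Nat.eq_of_mul_eq_mul_left hl h, mul_sum]
        exact sum_congr rfl fun k _ => by push_cast; rw [mul_pow, mul_inv]
    _ ≤ ((l : ℝ) ^ 2)⁻¹ * (2 / (((M / l : ℕ) : ℝ) + 1)) := by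
        gcongr
        exact sum_Ioo_inv_sq_le _ _
    _ = 2 / (l * (l * (((M / l : ℕ) : ℝ) + 1))) := by field_simp
    _ ≤ 2 / (l * M) := by
        gcongr
        have : M < l * (M / l + 1) := Nat.lt_mul_div_succ M hl
        exact_mod_cast this.le

lemma sum_inv_sq_mul_prod_le {P : Finset ℕ} (hP : ∀ p ∈ P, p.Prime) {b : ℕ → ℝ}
    (hb : ∀ p, 0 ≤ b p) {M : ℕ} (hM : 0 < M) (N : ℕ) :
    ∑ D ∈ Ioc M N, ((D : ℝ) ^ 2)⁻¹ * ∏ p ∈ P with p ∣ D, (1 + b p) ≤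
      2 / M * ∏ p ∈ P, (1 + b p / p) := by
  have hexp : ∀ D : ℕ, ∏ p ∈ P with p ∣ D, (1 + b p) =
      ∑ T ∈ P.powerset, if ∏ p ∈ T, p ∣ D then ∏ p ∈ T, b p else 0 := fun D => by
    rw [prod_one_add, ← sum_filter]
    refine sum_congr (Finset.ext fun T => ?_) fun _ _ => rfl
    simp only [mem_powerset, Finset.mem_filter]
    constructor
    · intro h
      refine ⟨h.trans (filter_subset _ _), Finset.prod_primes_dvd D (fun p hp => ?_) fun p hp => ?_⟩
      · exact (hP p (Finset.mem_filter.1 (h hp)).1).prime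
      · exact (Finset.mem_filter.1 (h hp)).2
    · rintro ⟨h, hd⟩ p hp
      exact Finset.mem_filter.2 ⟨h hp, (dvd_prod_of_mem _ hp).trans hd⟩
  calc _ = ∑ T ∈ P.powerset, (∏ p ∈ T, b p) *
        ∑ D ∈ Ioc M N with (∏ p ∈ T, p) ∣ D, ((D : ℝ) ^ 2)⁻¹ := by
        simp_rw [hexp, mul_sum]
        rw [sum_comm]
        refine sum_congr rfl fun T _ => ?_
        rw [sum_filter]
        refine sum_congr rfl fun D _ => ?_
        split_ifs <;> ring
    _ ≤ ∑ T ∈ P.powerset, (∏ p ∈ T, b p) * (2 / ((∏ p ∈ T, p : ℕ) * M)) := by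
        refine sum_le_sum fun T hT => mul_le_mul_of_nonneg_left ?_ (prod_nonneg fun p _ => hb p)
        exact sum_dvd_inv_sq_le (prod_pos fun p hp => (hP p (mem_powerset.1 hT hp)).pos) hM N
    _ = 2 / M * ∏ p ∈ P, (1 + b p / p) := by
        rw [prod_one_add, mul_sum]
        refine sum_congr rfl fun T _ => ?_
        rw [prod_div_distrib, Nat.cast_prod]
        ring

lemma sum_inv_sq_le_two {P : Finset ℕ} (hP : ∀ p ∈ P, 0 < p) :
    ∑ p ∈ P, ((p : ℝ) ^ 2)⁻¹ ≤ 2 := by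
  have hsub : P ⊆ Ioo 0 (P.sup id + 1) := fun p hp =>
    Finset.mem_Ioo.2 ⟨hP p hp, Nat.lt_succ_of_le (le_sup (f := id) hp)⟩
  refine (sum_le_sum_of_subset_of_nonneg hsub fun _ _ _ => by positivity).trans ?_
  simpa using sum_Ioo_inv_sq_le (α := ℝ) 0 (P.sup id + 1)

lemma abs_leg_le_one (p : ℕ) : |(leg p : ℝ)| ≤ 1 := by
  unfold leg
  split_ifs with h
  · have := Fact.mk h
    by_cases h2 : ((-2 : ℤ) : ZMod p) = 0
    · rw [(legendreSym.eq_zero_iff p (-2)).2 h2]; simp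
    · rcases legendreSym.eq_one_or_neg_one p h2 with h3 | h3 <;> rw [h3] <;> simp
  · simp

/-- The Euler weight `1 + (-2/p) / p`. -/
noncomputable def weight (p : ℕ) : ℝ := 1 + (leg p : ℝ) / p

lemma abs_leg_div_le (p : ℕ) : |(leg p : ℝ) / p| ≤ 1 / p := by
  rw [abs_div, Nat.abs_cast]
  gcongr
  exact abs_leg_le_one p

lemma weight_le (p : ℕ) : weight p ≤ 1 + 1 / p := by
  have := (abs_le.1 (abs_leg_div_le p)).2
  unfold weight
  linarith

lemma le_weight (p : ℕ) : 1 - 1 / p ≤ weight p := by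
  have := (abs_le.1 (abs_leg_div_le p)).1
  unfold weight
  linarith

lemma weight_pos (p : ℕ) : 0 < weight p := by
  by_cases hp : p.Prime
  · have h2 : (2 : ℝ) ≤ p := by exact_mod_cast hp.two_le
    have : 1 / (p : ℝ) ≤ 1 / 2 := by gcongr
    linarith [le_weight p]
  · simp [weight, leg, hp]

lemma inv_weight_sq_le {p : ℕ} (hp : 3 ≤ p) : (weight p ^ 2)⁻¹ ≤ 1 + 4 / p := by
  have h3 : (3 : ℝ) ≤ p := by exact_mod_cast hp
  have h0 : (0 : ℝ) < 1 - 1 / p := by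
    rw [sub_pos, div_lt_one (by linarith)]; linarith
  have h1 : (weight p ^ 2)⁻¹ ≤ ((1 - 1 / (p : ℝ)) ^ 2)⁻¹ := by
    gcongr
    exact le_weight p
  refine h1.trans (inv_le_of_inv_le₀ (by positivity) ?_)
  rw [inv_le_iff_one_le_mul₀ (by positivity)]
  have h4 : (1 - 1 / (p : ℝ)) ^ 2 * (1 + 4 / p) = 1 + (2 * (p : ℝ) ^ 2 - 7 * p + 4) / p ^ 3 := by
    field_simp
    ring
  rw [h4]
  have : 0 ≤ (2 * (p : ℝ) ^ 2 - 7 * p + 4) / p ^ 3 := by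
    apply div_nonneg _ (by positivity)
    nlinarith
  linarith

/-- The odd primes up to `y`. -/
def oddPrimes (y : ℕ) : Finset ℕ := (range (y + 1)).filter fun p => p.Prime ∧ p ≠ 2

lemma mem_oddPrimes {y p : ℕ} : p ∈ oddPrimes y ↔ p ≤ y ∧ p.Prime ∧ p ≠ 2 := by
  simp [oddPrimes]

lemma three_le_of_mem_oddPrimes {y p : ℕ} (hp : p ∈ oddPrimes y) : 3 ≤ p := by
  obtain ⟨-, h, h2⟩ := mem_oddPrimes.1 hp
  have := h.two_le
  omega

lemma F_eq {D N : ℕ} (hD : 0 < D) (hN : D ≤ N) :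
    F D = D * ∏ p ∈ oddPrimes N with p ∣ D, weight p := by
  unfold F weight
  congr 2
  ext p
  simp only [Finset.mem_filter, Nat.mem_primeFactors, mem_oddPrimes]
  constructor
  · rintro ⟨⟨h1, h2, -⟩, h3⟩
    exact ⟨⟨(Nat.le_of_dvd hD h2).trans hN, h1, h3⟩, h2⟩
  · rintro ⟨⟨-, h1, h3⟩, h2⟩
    exact ⟨⟨h1, h2, hD.ne'⟩, h3⟩

lemma card_weighted_lt_le (y : ℕ) {M : ℕ} (hM : 0 < M) (N : ℕ) (X : ℝ) :
    ((#{D ∈ Ioc M N | ((D : ℕ) : ℝ) * ∏ p ∈ oddPrimes y with p ∣ D, weight p < X} : ℕ) : ℝ) ≤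
      2 * Real.exp 8 * X ^ 2 / M := by
  have hpt : ∀ D ∈ (Ioc M N).filter
      (fun D : ℕ => (D : ℝ) * ∏ p ∈ oddPrimes y with p ∣ D, weight p < X),
      (1 : ℝ) ≤ X ^ 2 * (((D : ℝ) ^ 2)⁻¹ * ∏ p ∈ oddPrimes y with p ∣ D, (1 + 4 / (p : ℝ))) := by
    intro D hD
    obtain ⟨hD1, hD2⟩ := Finset.mem_filter.1 hD
    have hD0 : (0 : ℝ) < D := by exact_mod_cast hM.trans (Finset.mem_Ioc.1 hD1).1
    have hw0 : 0 < ∏ p ∈ oddPrimes y with p ∣ D, weight p := prod_pos fun p _ => weight_pos p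
    have hle : ((∏ p ∈ oddPrimes y with p ∣ D, weight p) ^ 2)⁻¹ ≤
        ∏ p ∈ oddPrimes y with p ∣ D, (1 + 4 / (p : ℝ)) := by
      rw [← prod_pow, ← prod_inv_distrib]
      exact prod_le_prod (fun p _ => by positivity) fun p hp =>
        inv_weight_sq_le (three_le_of_mem_oddPrimes (Finset.mem_filter.1 hp).1)
    calc (1 : ℝ) ≤ X ^ 2 * (((D : ℝ) * ∏ p ∈ oddPrimes y with p ∣ D, weight p) ^ 2)⁻¹ := by
          rw [← div_eq_mul_inv, one_le_div (by positivity)]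
          gcongr
      _ ≤ _ := by
          rw [mul_pow, mul_inv]
          gcongr
  have hprod : ∏ p ∈ oddPrimes y, (1 + 4 / (p : ℝ) / p) ≤ Real.exp 8 := by
    calc _ ≤ ∏ p ∈ oddPrimes y, Real.exp (4 / (p : ℝ) / p) :=
          prod_le_prod (fun p _ => by positivity) fun p _ => by
            rw [add_comm]; exact Real.add_one_le_exp _
      _ = Real.exp (4 * ∑ p ∈ oddPrimes y, ((p : ℝ) ^ 2)⁻¹) := by
          rw [← Real.exp_sum, mul_sum]
          congr 1
          exact sum_congr rfl fun p _ => by rw [div_div, ← sq, div_eq_mul_inv]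
      _ ≤ Real.exp 8 := by
          apply Real.exp_le_exp.2
          linarith [sum_inv_sq_le_two (P := oddPrimes y)
            fun p hp => (three_le_of_mem_oddPrimes hp).trans' (by norm_num)]
  calc _ ≤ ∑ D ∈ (Ioc M N).filter
          (fun D : ℕ => (D : ℝ) * ∏ p ∈ oddPrimes y with p ∣ D, weight p < X),
          X ^ 2 * (((D : ℝ) ^ 2)⁻¹ * ∏ p ∈ oddPrimes y with p ∣ D, (1 + 4 / (p : ℝ))) := by
        simpa using card_nsmul_le_sum _ _ 1 hpt
    _ ≤ ∑ D ∈ Ioc M N,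
          X ^ 2 * (((D : ℝ) ^ 2)⁻¹ * ∏ p ∈ oddPrimes y with p ∣ D, (1 + 4 / (p : ℝ))) :=
        sum_le_sum_of_subset_of_nonneg (filter_subset _ _) fun _ _ _ =>
          mul_nonneg (sq_nonneg _)
            (mul_nonneg (by positivity) (prod_nonneg fun _ _ => by positivity))
    _ ≤ X ^ 2 * (2 / M * Real.exp 8) := by
        rw [← mul_sum]
        gcongr
        refine (sum_inv_sq_mul_prod_le (fun p hp => (mem_oddPrimes.1 hp).2.1)
          (b := fun p => 4 / (p : ℝ)) (fun _ => by positivity) hM N).trans ?_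
        gcongr
    _ = _ := by ring

lemma card_tail_gt_le {δ : ℝ} (hδ : 0 < δ) {y : ℕ} (hy : 0 < y) (M : ℕ) :
    ((#{D ∈ Ioc 0 M | δ < ∑ n ∈ Ioo y (M + 1) with n ∣ D, 1 / (n : ℝ)} : ℕ) : ℝ) ≤
      2 * M / (δ * y) := by
  have hsum : ∑ D ∈ Ioc 0 M, ∑ n ∈ Ioo y (M + 1) with n ∣ D, 1 / (n : ℝ) ≤ 2 * M / y := by
    calc _ = ∑ n ∈ Ioo y (M + 1), (1 / (n : ℝ)) * ((M / n : ℕ) : ℝ) := by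
          simp_rw [sum_filter]
          rw [sum_comm]
          refine sum_congr rfl fun n _ => ?_
          rw [← sum_filter, sum_const, Nat.Ioc_filter_dvd_card_eq_div, nsmul_eq_mul, mul_comm]
      _ ≤ ∑ n ∈ Ioo y (M + 1), M * ((n : ℝ) ^ 2)⁻¹ := by
          refine sum_le_sum fun n _ => ?_
          calc _ ≤ (1 / (n : ℝ)) * (M / n) := by gcongr; exact Nat.cast_div_le
            _ = _ := by ring
      _ ≤ M * (2 / (y + 1)) := by
          rw [← mul_sum]
          gcongr
          exact sum_Ioo_inv_sq_le _ _
      _ ≤ M * (2 / y) := by gcongr; linarith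
      _ = _ := by ring
  rw [mul_comm δ, ← div_div, le_div_iff₀ hδ]
  refine le_trans ?_ hsum
  refine le_trans ?_ (sum_le_sum_of_subset_of_nonneg (filter_subset
    (fun D => δ < ∑ n ∈ Ioo y (M + 1) with n ∣ D, 1 / (n : ℝ)) _)
    fun _ _ _ => sum_nonneg fun _ _ => by positivity)
  rw [← nsmul_eq_mul]
  exact card_nsmul_le_sum _ _ _ fun D hD => (Finset.mem_filter.1 hD).2.le

lemma one_sub_sum_le_prod {s : Finset ℕ} {f : ℕ → ℝ} (h0 : ∀ i ∈ s, 0 ≤ f i)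
    (h1 : ∀ i ∈ s, f i ≤ 1) : 1 - ∑ i ∈ s, f i ≤ ∏ i ∈ s, (1 - f i) := by
  induction s using Finset.induction_on with
  | empty => simp
  | insert a s ha ih =>
    rw [sum_insert ha, prod_insert ha]
    have i := ih (fun i hi => h0 i (mem_insert_of_mem hi)) fun i hi => h1 i (mem_insert_of_mem hi)
    have ha0 := h0 a (mem_insert_self _ _)
    have ha1 := h1 a (mem_insert_self _ _)
    have hs : 0 ≤ ∑ i ∈ s, f i := sum_nonneg fun i hi => h0 i (mem_insert_of_mem hi)
    nlinarith [mul_le_mul_of_nonneg_left i (sub_nonneg.2 ha1)]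

lemma prod_weight_tail_bounds {δ : ℝ} {y M D : ℕ}
    (hs : ∑ n ∈ Ioo y (M + 1) with n ∣ D, 1 / (n : ℝ) ≤ δ) :
    1 - δ ≤ ∏ p ∈ oddPrimes M with y < p ∧ p ∣ D, weight p ∧
      (1 - δ) * ∏ p ∈ oddPrimes M with y < p ∧ p ∣ D, weight p ≤ 1 := by
  set T := (oddPrimes M).filter (fun p => y < p ∧ p ∣ D) with hT
  have hT1 : ∀ p ∈ T, 1 / (p : ℝ) ≤ 1 := fun p hp => by
    have h3 := three_le_of_mem_oddPrimes (Finset.mem_filter.1 hp).1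
    have : (1 : ℝ) ≤ p := by exact_mod_cast h3.trans' (by norm_num)
    exact div_le_one_of_le₀ this (by positivity)
  have hsub : T ⊆ (Ioo y (M + 1)).filter (· ∣ D) := fun p hp => by
    obtain ⟨h1, h2, h3⟩ := Finset.mem_filter.1 hp
    exact Finset.mem_filter.2
      ⟨Finset.mem_Ioo.2 ⟨h2, Nat.lt_succ_of_le (mem_oddPrimes.1 h1).1⟩, h3⟩
  have hsum : ∑ p ∈ T, 1 / (p : ℝ) ≤ δ :=
    (sum_le_sum_of_subset_of_nonneg hsub fun _ _ _ => by positivity).trans hs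
  have hlow : 1 - δ ≤ ∏ p ∈ T, (1 - 1 / (p : ℝ)) :=
    le_trans (by linarith) (one_sub_sum_le_prod (fun p _ => by positivity) hT1)
  refine ⟨hlow.trans (prod_le_prod (fun p hp => sub_nonneg.2 (hT1 p hp)) fun p _ => le_weight p), ?_⟩
  have hw : 0 ≤ ∏ p ∈ T, weight p := prod_nonneg fun p _ => (weight_pos p).le
  refine (mul_le_mul_of_nonneg_right hlow hw).trans ?_
  rw [← prod_mul_distrib]
  refine prod_le_one (fun p hp => mul_nonneg (sub_nonneg.2 (hT1 p hp)) (weight_pos p).le)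
    fun p hp => ?_
  calc _ ≤ (1 - 1 / (p : ℝ)) * (1 + 1 / p) :=
        mul_le_mul_of_nonneg_left (weight_le p) (sub_nonneg.2 (hT1 p hp))
    _ = 1 - (1 / (p : ℝ)) ^ 2 := by ring
    _ ≤ 1 := by linarith [sq_nonneg (1 / (p : ℝ))]

lemma F_eq_mul_tail {D M y : ℕ} (hD : 0 < D) (hM : D ≤ M) :
    F D = (D * ∏ p ∈ oddPrimes y with p ∣ D, weight p) *
      ∏ p ∈ oddPrimes M with y < p ∧ p ∣ D, weight p := by
  rw [F_eq hD hM, mul_assoc]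
  congr 1
  rw [← prod_union]
  · refine prod_congr (Finset.ext fun p => ?_) fun _ _ => rfl
    simp only [Finset.mem_filter, Finset.mem_union, mem_oddPrimes]
    constructor
    · rintro ⟨⟨h1, h2⟩, h3⟩
      rcases le_or_gt p y with h | h
      · exact Or.inl ⟨⟨h, h2⟩, h3⟩
      · exact Or.inr ⟨⟨h1, h2⟩, h, h3⟩
    · rintro (⟨⟨h1, h2⟩, h3⟩ | ⟨⟨h1, h2⟩, h, h3⟩)
      · exact ⟨⟨(Nat.le_of_dvd hD h3).trans hM, h2⟩, h3⟩
      · exact ⟨⟨h1, h2⟩, h3⟩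
  · rw [Finset.disjoint_left]
    intro p h1 h2
    have := (mem_oddPrimes.1 (Finset.mem_filter.1 h1).1).1
    have := (Finset.mem_filter.1 h2).2.1
    omega

lemma finite_and_ncard_le_of_card_filter_le {p : ℕ → Prop} [DecidablePred p] {M : ℕ} {B : ℝ}
    (h : ∀ N, ((#{D ∈ Ioc M N | p D} : ℕ) : ℝ) ≤ B) :
    {D | M < D ∧ p D}.Finite ∧ ({D | M < D ∧ p D}.ncard : ℝ) ≤ B := by
  have hfin : {D | M < D ∧ p D}.Finite := by
    by_contra hinf
    obtain ⟨t, ht, htc⟩ := Set.Infinite.exists_subset_card_eq hinf (⌊B⌋₊ + 1)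
    have hsub : t ⊆ (Ioc M (t.sup id)).filter p := fun D hD =>
      Finset.mem_filter.2 ⟨Finset.mem_Ioc.2 ⟨(ht hD).1, le_sup (f := id) hD⟩, (ht hD).2⟩
    have h1 : ((⌊B⌋₊ + 1 : ℕ) : ℝ) ≤ B :=
      le_trans (by rw [← htc]; exact_mod_cast card_le_card hsub) (h (t.sup id))
    have := Nat.lt_floor_add_one B
    push_cast at h1
    linarith
  refine ⟨hfin, ?_⟩
  have hsub : hfin.toFinset ⊆ (Ioc M (hfin.toFinset.sup id)).filter p := fun D hD =>
    Finset.mem_filter.2 ⟨Finset.mem_Ioc.2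
      ⟨(hfin.mem_toFinset.1 hD).1, le_sup (f := id) hD⟩, (hfin.mem_toFinset.1 hD).2⟩
  rw [Set.ncard_eq_toFinset_card _ hfin]
  exact le_trans (by exact_mod_cast card_le_card hsub) (h (hfin.toFinset.sup id))

lemma large_weighted {M : ℕ} (hM : 0 < M) (y : ℕ) (X : ℝ) :
    {D : ℕ | M < D ∧ (D : ℝ) * ∏ p ∈ oddPrimes y with p ∣ D, weight p < X}.Finite ∧
    ({D : ℕ | M < D ∧ (D : ℝ) * ∏ p ∈ oddPrimes y with p ∣ D, weight p < X}.ncard : ℝ) ≤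
      2 * Real.exp 8 * X ^ 2 / M :=
  finite_and_ncard_le_of_card_filter_le fun N => card_weighted_lt_le y hM N X

open Classical in
lemma large_F {M : ℕ} (hM : 0 < M) (X : ℝ) :
    {D : ℕ | M < D ∧ F D < X}.Finite ∧
    ({D : ℕ | M < D ∧ F D < X}.ncard : ℝ) ≤ 2 * Real.exp 8 * X ^ 2 / M := by
  refine finite_and_ncard_le_of_card_filter_le fun N => ?_
  refine le_trans (le_of_eq ?_) (card_weighted_lt_le N hM N X)
  congr 2
  ext D
  simp only [Finset.mem_filter, and_congr_right_iff, Finset.mem_Ioc]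
  intro hD
  rw [F_eq (by omega) hD.2]

/-- Positive integers `D ≡ r (mod m)` with `F D < X`. -/
def targetSet (m : ℕ) (r : ℤ) (X : ℝ) : Set ℕ :=
  {D | 0 < D ∧ (D : ℤ) ≡ r [ZMOD (m : ℤ)] ∧ F D < X}

lemma targetSet_finite (m : ℕ) (r : ℤ) (X : ℝ) : (targetSet m r X).Finite := by
  refine ((Set.finite_Iic 1).union (large_F one_pos X).1).subset fun D hD => ?_
  rcases le_or_gt D 1 with h | h
  · exact Or.inl h
  · exact Or.inr ⟨h, hD.2.2⟩

lemma ncard_targetSet_le {δ : ℝ} (hδ : 0 < δ) (hδ1 : δ < 1) {y M : ℕ} (hy : 0 < y) (hM : 0 < M)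
    (m : ℕ) (r : ℤ) (X : ℝ) :
    ((targetSet m r X).ncard : ℝ) ≤
      (weightedSet weight (oddPrimes y) m r (X / (1 - δ))).ncard +
        (2 * Real.exp 8 * X ^ 2 / M + 2 * M / (δ * y)) := by
  have h0 : 0 < 1 - δ := by linarith
  obtain ⟨hf, hc⟩ := large_F hM X
  have ht := card_tail_gt_le hδ hy M
  rw [← Set.ncard_coe_finset] at ht
  set B := ((Ioc 0 M).filter (fun D => δ < ∑ n ∈ Ioo y (M + 1) with n ∣ D, 1 / (n : ℝ)) : Finset ℕ)
  have hsub : targetSet m r X ⊆ weightedSet weight (oddPrimes y) m r (X / (1 - δ)) ∪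
      ({D : ℕ | M < D ∧ F D < X} ∪ B) := by
    rintro D ⟨hD0, hDr, hX⟩
    rcases lt_or_ge M D with hMD | hMD
    · exact Or.inr (Or.inl ⟨hMD, hX⟩)
    by_cases hs : δ < ∑ n ∈ Ioo y (M + 1) with n ∣ D, 1 / (n : ℝ)
    · exact Or.inr (Or.inr (Finset.mem_coe.2 (Finset.mem_filter.2
        ⟨Finset.mem_Ioc.2 ⟨hD0, hMD⟩, hs⟩)))
    refine Or.inl ⟨hD0, hDr, ?_⟩
    rw [F_eq_mul_tail (y := y) hD0 hMD] at hX
    rw [lt_div_iff₀ h0]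
    refine lt_of_le_of_lt (mul_le_mul_of_nonneg_left
      (prod_weight_tail_bounds (not_lt.1 hs)).1 ?_) hX
    exact mul_nonneg (Nat.cast_nonneg _) (prod_nonneg fun p _ => (weight_pos p).le)
  have h1 := Set.ncard_le_ncard hsub
    ((weightedSet_finite weight_pos _ _ _ _).union (hf.union B.finite_toSet))
  have h2 := h1.trans ((Set.ncard_union_le _ _).trans
    (Nat.add_le_add_left (Set.ncard_union_le _ _) _))
  have h3 := (Nat.cast_le (α := ℝ)).2 h2
  push_cast at h3
  linarith

lemma ncard_weightedSet_le {δ : ℝ} (hδ : 0 < δ) (hδ1 : δ < 1) {y M : ℕ} (hy : 0 < y) (hM : 0 < M)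
    (m : ℕ) (r : ℤ) {X : ℝ} (hX0 : 0 ≤ X) :
    ((weightedSet weight (oddPrimes y) m r ((1 - δ) * X)).ncard : ℝ) ≤
      (targetSet m r X).ncard + (2 * Real.exp 8 * X ^ 2 / M + 2 * M / (δ * y)) := by
  have h0 : 0 < 1 - δ := by linarith
  obtain ⟨hf, hc⟩ := large_weighted hM y X
  have ht := card_tail_gt_le hδ hy M
  rw [← Set.ncard_coe_finset] at ht
  set B := ((Ioc 0 M).filter (fun D => δ < ∑ n ∈ Ioo y (M + 1) with n ∣ D, 1 / (n : ℝ)) : Finset ℕ)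
  have hsub : weightedSet weight (oddPrimes y) m r ((1 - δ) * X) ⊆ targetSet m r X ∪
      ({D : ℕ | M < D ∧ (D : ℝ) * ∏ p ∈ oddPrimes y with p ∣ D, weight p < X} ∪ B) := by
    rintro D ⟨hD0, hDr, hX⟩
    rcases lt_or_ge M D with hMD | hMD
    · exact Or.inr (Or.inl ⟨hMD, hX.trans_le (by nlinarith)⟩)
    by_cases hs : δ < ∑ n ∈ Ioo y (M + 1) with n ∣ D, 1 / (n : ℝ)
    · exact Or.inr (Or.inr (Finset.mem_coe.2 (Finset.mem_filter.2
        ⟨Finset.mem_Ioc.2 ⟨hD0, hMD⟩, hs⟩)))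
    refine Or.inl ⟨hD0, hDr, ?_⟩
    have htail := (prod_weight_tail_bounds (not_lt.1 hs)).2
    have hpos : 0 < ∏ p ∈ oddPrimes M with y < p ∧ p ∣ D, weight p :=
      prod_pos fun p _ => weight_pos p
    rw [F_eq_mul_tail (y := y) hD0 hMD]
    calc _ < (1 - δ) * X * ∏ p ∈ oddPrimes M with y < p ∧ p ∣ D, weight p :=
          mul_lt_mul_of_pos_right hX hpos
      _ = ((1 - δ) * ∏ p ∈ oddPrimes M with y < p ∧ p ∣ D, weight p) * X := by ring
      _ ≤ 1 * X := mul_le_mul_of_nonneg_right htail hX0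
      _ = X := one_mul X
  have h1 := Set.ncard_le_ncard hsub
    ((targetSet_finite _ _ _).union (hf.union B.finite_toSet))
  have h2 := h1.trans ((Set.ncard_union_le _ _).trans
    (Nat.add_le_add_left (Set.ncard_union_le _ _) _))
  have h3 := (Nat.cast_le (α := ℝ)).2 h2
  push_cast at h3
  linarith

lemma error_le {k : ℕ} (hk : 0 < k) {X : ℝ} (hX : 1 ≤ X) :
    2 * Real.exp 8 * X ^ 2 / (⌈k * X⌉₊ : ℝ) + 2 * (⌈k * X⌉₊ : ℝ) / (1 / k * ((k ^ 3 : ℕ) : ℝ)) ≤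
      (2 * Real.exp 8 + 4) / k * X := by
  have hk1 : (1 : ℝ) ≤ k := by exact_mod_cast hk
  have hX0 : 0 < X := by linarith
  have h1 : k * X ≤ ⌈k * X⌉₊ := Nat.le_ceil _
  have h2 : (⌈k * X⌉₊ : ℝ) ≤ 2 * (k * X) := by
    have := Nat.ceil_lt_add_one (by positivity : 0 ≤ k * X)
    nlinarith
  calc _ ≤ 2 * Real.exp 8 * X ^ 2 / (k * X) +
        2 * (2 * (k * X)) / (1 / k * ((k ^ 3 : ℕ) : ℝ)) := by gcongr
    _ = _ := by
      push_cast
      field_simp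
      ring

lemma tendsto_prod_oddPrimes : Tendsto (fun y : ℕ => ∏ p ∈ oddPrimes y,
    (1 - 1 / (p : ℝ) + 1 / (p * weight p))) atTop (𝓝 Cconst) := by
  have hterm : ∀ p : {p : ℕ // p.Prime ∧ p ≠ 2},
      1 - 1 / (p.1 : ℝ) + 1 / ((p.1 : ℝ) + (leg p.1 : ℝ)) =
        1 + -((leg p.1 : ℝ) / (p.1 * (p.1 + leg p.1))) := fun p => by
    have h2 : (2 : ℝ) ≤ p.1 := by exact_mod_cast p.2.1.two_le
    have h1 := (abs_le.1 (abs_leg_le_one p.1)).1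
    have h3 : (p.1 : ℝ) + leg p.1 ≠ 0 := by linarith
    have h4 : (p.1 : ℝ) ≠ 0 := by linarith
    field_simp
    ring
  have hmul : Multipliable fun p : {p : ℕ // p.Prime ∧ p ≠ 2} =>
      (1 - 1 / (p.1 : ℝ) + 1 / ((p.1 : ℝ) + (leg p.1 : ℝ))) := by
    simp_rw [hterm]
    apply Real.multipliable_one_add_of_summable
    have hs : Summable fun p : {p : ℕ // p.Prime ∧ p ≠ 2} => 2 * ((p.1 : ℝ) ^ 2)⁻¹ :=
      ((Real.summable_nat_pow_inv.2 one_lt_two).mul_left 2).subtype _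
    refine Summable.of_norm_bounded hs fun p => ?_
    have h2 : (2 : ℝ) ≤ p.1 := by exact_mod_cast p.2.1.two_le
    have h1 := (abs_le.1 (abs_leg_le_one p.1)).1
    have h3 : (p.1 : ℝ) / 2 ≤ p.1 + leg p.1 := by linarith
    have h4 : 0 < (p.1 : ℝ) + leg p.1 := by linarith
    rw [norm_neg, Real.norm_eq_abs, abs_div, abs_of_pos (by positivity : 0 < (p.1 : ℝ) * _)]
    calc _ ≤ 1 / ((p.1 : ℝ) * (p.1 / 2)) := by
          gcongr
          exact abs_leg_le_one _
      _ = _ := by field_simp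
  have hprod := hmul.hasProd
  set g : ℕ → ℝ := fun p => 1 - 1 / (p : ℝ) + 1 / ((p : ℝ) + (leg p : ℝ)) with hg
  have hprod' : HasProd (Set.mulIndicator {p : ℕ | p.Prime ∧ p ≠ 2} g) Cconst :=
    hasProd_subtype_iff_mulIndicator.1 hprod
  refine ((tendsto_add_atTop_iff_nat 1).2 hprod'.tendsto_prod_nat).congr fun y => ?_
  rw [oddPrimes, prod_filter]
  refine prod_congr rfl fun p _ => ?_
  rw [Set.mulIndicator_apply]
  split_ifs with h1 h2 h2
  · have : (p : ℝ) ≠ 0 := by exact_mod_cast h2.1.ne_zero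
    simp only [hg, weight]
    rw [mul_add, mul_one, mul_div_cancel₀ _ this]
  · exact absurd h1 h2
  · exact absurd h2 h1
  · rfl

lemma tendsto_of_sandwich {f : ℝ → ℝ} {l u : ℕ → ℝ → ℝ} {l' u' : ℕ → ℝ} {L : ℝ}
    (hl : ∀ᶠ k in atTop, Tendsto (l k) atTop (𝓝 (l' k)))
    (hu : ∀ᶠ k in atTop, Tendsto (u k) atTop (𝓝 (u' k)))
    (hlf : ∀ᶠ k in atTop, ∀ᶠ X in atTop, l k X ≤ f X)
    (hfu : ∀ᶠ k in atTop, ∀ᶠ X in atTop, f X ≤ u k X)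
    (hl' : Tendsto l' atTop (𝓝 L)) (hu' : Tendsto u' atTop (𝓝 L)) : Tendsto f atTop (𝓝 L) := by
  refine tendsto_order.2 ⟨fun a ha => ?_, fun b hb => ?_⟩
  · obtain ⟨k, h1, h2, h3⟩ := (hl.and (hlf.and (hl'.eventually_const_lt ha))).exists
    filter_upwards [h1.eventually_const_lt h3, h2] with X h4 h5 using h4.trans_le h5
  · obtain ⟨k, h1, h2, h3⟩ := (hu.and (hfu.and (hu'.eventually_lt_const hb))).exists
    filter_upwards [h1.eventually_lt_const h3, h2] with X h4 h5 using h5.trans_lt h4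

lemma tendsto_ncard_targetSet {m : ℕ} (hm : 0 < m) (hodd : ∀ p : ℕ, p.Prime → p ≠ 2 → m.Coprime p)
    (r : ℤ) :
    Tendsto (fun X : ℝ => ((targetSet m r X).ncard : ℝ) / X) atTop (𝓝 (Cconst / m)) := by
  set W : ℕ → ℝ → ℝ := fun k X => (weightedSet weight (oddPrimes (k ^ 3)) m r X).ncard with hW
  set P : ℕ → ℝ := fun k =>
    (∏ p ∈ oddPrimes (k ^ 3), (1 - 1 / (p : ℝ) + 1 / (p * weight p))) / m with hP
  set c : ℝ := 2 * Real.exp 8 + 4 with hc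
  have hWP : ∀ k, Tendsto (fun X => W k X / X) atTop (𝓝 (P k)) := fun k =>
    tendsto_ncard_weightedSet weight_pos _ (fun p hp => (mem_oddPrimes.1 hp).2.1) hm
      (fun p hp => hodd p (mem_oddPrimes.1 hp).2.1 (mem_oddPrimes.1 hp).2.2) r
  have hPlim : Tendsto P atTop (𝓝 (Cconst / m)) :=
    (tendsto_prod_oddPrimes.comp (tendsto_pow_atTop (by norm_num))).div_const _
  have hinv : Tendsto (fun k : ℕ => 1 - 1 / (k : ℝ)) atTop (𝓝 1) := by
    simpa using (tendsto_one_div_atTop_nhds_zero_nat (𝕜 := ℝ)).const_sub 1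
  have hck : Tendsto (fun k : ℕ => c / (k : ℝ)) atTop (𝓝 0) :=
    tendsto_const_nhds.div_atTop tendsto_natCast_atTop_atTop
  have hδ : ∀ k : ℕ, 2 ≤ k → 0 < 1 / (k : ℝ) ∧ 1 / (k : ℝ) < 1 := fun k hk => by
    have : (2 : ℝ) ≤ k := by exact_mod_cast hk
    exact ⟨by positivity, by rw [div_lt_one] <;> linarith⟩
  refine tendsto_of_sandwich
    (l := fun k X => W k ((1 - 1 / k) * X) / ((1 - 1 / k) * X) * (1 - 1 / k) - c / k)
    (u := fun k X => W k (X / (1 - 1 / k)) / (X / (1 - 1 / k)) / (1 - 1 / k) + c / k)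
    (l' := fun k => P k * (1 - 1 / k) - c / k) (u' := fun k => P k / (1 - 1 / k) + c / k)
    ?_ ?_ ?_ ?_ ?_ ?_
  · filter_upwards [eventually_ge_atTop 2] with k hk
    have h0 : 0 < 1 - 1 / (k : ℝ) := by linarith [hδ k hk]
    exact (((hWP k).comp (tendsto_id.const_mul_atTop h0)).mul_const _).sub_const _
  · filter_upwards [eventually_ge_atTop 2] with k hk
    have h0 : 0 < 1 - 1 / (k : ℝ) := by linarith [hδ k hk]
    exact (((hWP k).comp (tendsto_id.atTop_div_const h0)).div_const _).add_const _
  · filter_upwards [eventually_ge_atTop 2] with k hk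
    filter_upwards [eventually_ge_atTop 1] with X hX
    have hX0 : 0 < X := by linarith
    have h0 : 0 < 1 - 1 / (k : ℝ) := by linarith [hδ k hk]
    have hk0 : 0 < k := by omega
    have hM : 0 < ⌈k * X⌉₊ := Nat.ceil_pos.2 (by positivity)
    have key := ncard_weightedSet_le (hδ k hk).1 (hδ k hk).2 (pow_pos hk0 3) hM m r hX0.le
    have herr := error_le hk0 hX
    rw [le_div_iff₀ hX0]
    have : (W k ((1 - 1 / k) * X) / ((1 - 1 / k) * X) * (1 - 1 / k) - c / k) * X =
        W k ((1 - 1 / k) * X) - c / k * X := by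
      rw [div_mul_eq_mul_div, mul_comm (1 - 1 / (k : ℝ)) X, mul_div_mul_right _ _ h0.ne', sub_mul,
        div_mul_cancel₀ _ hX0.ne']
    rw [this]
    linarith
  · filter_upwards [eventually_ge_atTop 2] with k hk
    filter_upwards [eventually_ge_atTop 1] with X hX
    have hX0 : 0 < X := by linarith
    have h0 : 0 < 1 - 1 / (k : ℝ) := by linarith [hδ k hk]
    have hk0 : 0 < k := by omega
    have hM : 0 < ⌈k * X⌉₊ := Nat.ceil_pos.2 (by positivity)
    have key := ncard_targetSet_le (hδ k hk).1 (hδ k hk).2 (pow_pos hk0 3) hM m r X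
    have herr := error_le hk0 hX
    rw [div_le_iff₀ hX0]
    have : (W k (X / (1 - 1 / k)) / (X / (1 - 1 / k)) / (1 - 1 / k) + c / k) * X =
        W k (X / (1 - 1 / k)) + c / k * X := by
      rw [div_div, div_mul_cancel₀ _ h0.ne', add_mul, div_mul_cancel₀ _ hX0.ne']
    rw [this]
    linarith
  · simpa using (hPlim.mul hinv).sub hck
  · simpa using (hPlim.div hinv one_ne_zero).add hck

/-- For every a ≥ 0 and every integer r, the number of positive integers D with
D ≡ r (mod 2^a) and F(D) < X is asymptotic to (C/2^a)·X as X → ∞. -/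
theorem stmt_18 (a : ℕ) (r : ℤ) :
    Filter.Tendsto
      (fun X : ℝ =>
        (Nat.card {D : ℕ // 0 < D ∧ (D : ℤ) ≡ r [ZMOD (2 ^ a : ℤ)] ∧ F D < X} : ℝ) / X)
      Filter.atTop (nhds (Cconst / 2 ^ a)) := by
  have h := tendsto_ncard_targetSet (m := 2 ^ a) (by positivity)
    (fun p hp h2 => Nat.Coprime.pow_left a ((Nat.coprime_primes Nat.prime_two hp).2 h2.symm)) r
  push_cast at h
  simp only [← Nat.card_coe_set_eq, targetSet, Nat.cast_pow, Nat.cast_ofNat] at h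
  exact h
end

section
/- Define Π(x) to be the sum of the following nine counting functions of positive integers D: #{D ≡ 0 (mod 8) : π·F(D) < x}, #{D ≢ 0 (mod 8) : 2π·F(D) < x}, #{D ≡ 1 (mod 8) : π·F(D) < x}, #{D ≡ 5 (mod 8) : (π/3)·F(D) < x}, #{D ≡ 2 (mod 16) : (π/6)·F(D) < x}, #{D ≡ 6 (mod 16) : (π/6)·F(D) < x}, #{D ≡ 2 (mod 4) : (π/2)·F(D) < x}, #{D ≡ 3 (mod 8) : π·F(D) < x}, and #{D ≡ 7 (mod 8) : (π/3)·F(D) < x}. Then Π(x)/x → (45/(16π))·C as x → ∞, where C = ∏_{p odd prime} (1 − 1/p + 1/(p + (−2/p))). (This quantity Π(x) counts the primitive totally geodesic immersed surfaces of area less than x in the Bianchi orbifold PSL(2, ℤ[√−2])\ℍ³, via the classification of maximal nonelementary Fuchsian subgroups and their covolumes.) -/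
open Real

open Filter Topology

/-- The product of `f p` over the odd primes `p` dividing `D`. -/
noncomputable def oddPrimeProd (f : ℕ → ℝ) (D : ℕ) : ℝ :=
  ∏ p ∈ D.primeFactors.filter (fun p => p ≠ 2), f p

/-- The function equal to `f` on `S` and to `1` elsewhere. -/
noncomputable def restrictOne (S : Finset ℕ) (f : ℕ → ℝ) (p : ℕ) : ℝ :=
  if p ∈ S then f p else 1

/-- The set of positive integers `D ≡ a (mod m)` with `D < y * ∏ f p`, the product being over the
odd primes `p` dividing `D`. -/
def progressionSet (f : ℕ → ℝ) (m a : ℕ) (y : ℝ) : Set ℕ :=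
  {D | 0 < D ∧ D ≡ a [MOD m] ∧ (D : ℝ) < y * oddPrimeProd f D}

lemma oddPrimeProd_mul (f g : ℕ → ℝ) (D : ℕ) :
    oddPrimeProd (fun p => f p * g p) D = oddPrimeProd f D * oddPrimeProd g D :=
  Finset.prod_mul_distrib

lemma mem_oddPrimes_s19 {D p : ℕ} (hp : p ∈ D.primeFactors.filter (fun p => p ≠ 2)) :
    p.Prime ∧ p ≠ 2 := by
  rw [Finset.mem_filter] at hp
  exact ⟨Nat.prime_of_mem_primeFactors hp.1, hp.2⟩

lemma oddPrimeProd_mono {f g : ℕ → ℝ} (hf : ∀ p, p.Prime → p ≠ 2 → 0 ≤ f p)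
    (h : ∀ p, p.Prime → p ≠ 2 → f p ≤ g p) (D : ℕ) : oddPrimeProd f D ≤ oddPrimeProd g D :=
  Finset.prod_le_prod (fun p hp => hf p (mem_oddPrimes_s19 hp).1 (mem_oddPrimes_s19 hp).2)
    (fun p hp => h p (mem_oddPrimes_s19 hp).1 (mem_oddPrimes_s19 hp).2)

lemma oddPrimeProd_pos {f : ℕ → ℝ} (hf : ∀ p, p.Prime → p ≠ 2 → 0 < f p) (D : ℕ) :
    0 < oddPrimeProd f D :=
  Finset.prod_pos fun p hp => hf p (mem_oddPrimes_s19 hp).1 (mem_oddPrimes_s19 hp).2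

lemma oddPrimeProd_one (D : ℕ) : oddPrimeProd (fun _ => 1) D = 1 := by simp [oddPrimeProd]

lemma one_le_oddPrimeProd {f : ℕ → ℝ} (hf : ∀ p, p.Prime → p ≠ 2 → 1 ≤ f p) (D : ℕ) :
    1 ≤ oddPrimeProd f D := by
  simpa [oddPrimeProd_one] using
    oddPrimeProd_mono (f := fun _ => 1) (g := f) (fun _ _ _ => zero_le_one) hf D

lemma oddPrimeProd_restrictOne_empty (f : ℕ → ℝ) (D : ℕ) :
    oddPrimeProd (restrictOne ∅ f) D = 1 := by
  simp [oddPrimeProd, restrictOne]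

lemma oddPrimeProd_restrictOne_insert (f : ℕ → ℝ) {S : Finset ℕ} {p D : ℕ} (hpS : p ∉ S)
    (hp : p.Prime) (hp2 : p ≠ 2) (hD : D ≠ 0) :
    oddPrimeProd (restrictOne (insert p S) f) D =
      (if p ∣ D then f p else 1) * oddPrimeProd (restrictOne S f) D := by
  have h : restrictOne (insert p S) f =
      fun q => (if q = p then f q else 1) * restrictOne S f q := by
    funext q
    by_cases hq : q = p
    · subst hq; simp [restrictOne, hpS]
    · simp [restrictOne, hq]
  rw [h, oddPrimeProd_mul]
  congr 1
  rw [oddPrimeProd, Finset.prod_ite_eq']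
  simp [hp, hp2, hD]

lemma oddPrimeProd_restrictOne_prime_mul (f : ℕ → ℝ) {S : Finset ℕ} {p m : ℕ} (hpS : p ∉ S)
    (hp : p.Prime) (hm : m ≠ 0) :
    oddPrimeProd (restrictOne S f) (p * m) = oddPrimeProd (restrictOne S f) m := by
  rw [oddPrimeProd, oddPrimeProd, Nat.primeFactors_mul hp.ne_zero hm, hp.primeFactors]
  symm
  refine Finset.prod_subset (Finset.filter_subset_filter _ Finset.subset_union_right) ?_
  intro q hq hq'
  have : q = p := by
    simp only [Finset.mem_filter, Finset.mem_union, Finset.mem_singleton] at hq hq'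
    tauto
  simp [restrictOne, this, hpS]

/-- The mean value of a multiplicative weight supported on finitely many primes. -/
lemma sum_oddPrimeProd_restrictOne_le {f : ℕ → ℝ} (hf : ∀ p, 1 ≤ f p) (S : Finset ℕ)
    (hS : ∀ p ∈ S, p.Prime ∧ p ≠ 2) (N : ℕ) :
    ∑ D ∈ Finset.Icc 1 N, oddPrimeProd (restrictOne S f) D ≤
      N * ∏ p ∈ S, (1 + (f p - 1) / p) := by
  induction S using Finset.induction_on generalizing N with
  | empty => simp [oddPrimeProd_restrictOne_empty]
  | insert p S hpS ih =>
    obtain ⟨hp, hp2⟩ := hS p (Finset.mem_insert_self p S)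
    have ih' := ih fun q hq => hS q (Finset.mem_insert_of_mem hq)
    have hp0 : (0 : ℝ) < p := by exact_mod_cast hp.pos
    have hmul : ∑ D ∈ (Finset.Icc 1 N).filter (p ∣ ·), oddPrimeProd (restrictOne S f) D =
        ∑ m ∈ Finset.Icc 1 (N / p), oddPrimeProd (restrictOne S f) m := by
      symm
      refine Finset.sum_bij (fun m _ => p * m) ?_ ?_ ?_ ?_
      · intro m hm
        simp only [Finset.mem_Icc, Finset.mem_filter] at hm ⊢
        refine ⟨⟨Nat.mul_pos hp.pos hm.1, ?_⟩, dvd_mul_right _ _⟩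
        rw [mul_comm]
        exact (Nat.le_div_iff_mul_le hp.pos).1 hm.2
      · intro a _ b _ h
        exact Nat.eq_of_mul_eq_mul_left hp.pos h
      · rintro D hD
        simp only [Finset.mem_Icc, Finset.mem_filter] at hD
        obtain ⟨⟨h1, h2⟩, m, rfl⟩ := hD
        refine ⟨m, ?_, rfl⟩
        rw [Finset.mem_Icc, Nat.le_div_iff_mul_le hp.pos, mul_comm m]
        exact ⟨Nat.pos_of_mul_pos_left h1, h2⟩
      · intro m hm
        rw [Finset.mem_Icc] at hm
        exact (oddPrimeProd_restrictOne_prime_mul f hpS hp (by omega)).symm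
    have hsplit : ∑ D ∈ Finset.Icc 1 N, oddPrimeProd (restrictOne (insert p S) f) D =
        ∑ D ∈ Finset.Icc 1 N, oddPrimeProd (restrictOne S f) D + (f p - 1) *
          ∑ m ∈ Finset.Icc 1 (N / p), oddPrimeProd (restrictOne S f) m := by
      rw [← hmul, Finset.sum_filter, Finset.mul_sum, ← Finset.sum_add_distrib]
      refine Finset.sum_congr rfl fun D hD => ?_
      rw [Finset.mem_Icc] at hD
      rw [oddPrimeProd_restrictOne_insert f hpS hp hp2 (by omega)]
      split_ifs <;> ring
    have hprod : 0 ≤ ∏ q ∈ S, (1 + (f q - 1) / q) :=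
      Finset.prod_nonneg fun q _ => add_nonneg zero_le_one
        (div_nonneg (sub_nonneg.2 (hf q)) (Nat.cast_nonneg q))
    rw [hsplit, Finset.prod_insert hpS]
    calc _ ≤ N * ∏ q ∈ S, (1 + (f q - 1) / q) +
          (f p - 1) * ((N / p : ℝ) * ∏ q ∈ S, (1 + (f q - 1) / q)) := by
          refine add_le_add (ih' N) (mul_le_mul_of_nonneg_left ?_ (sub_nonneg.2 (hf p)))
          exact (ih' (N / p)).trans (mul_le_mul_of_nonneg_right Nat.cast_div_le hprod)
      _ = _ := by ring

/-- A cumulative bound `A(n) ≤ P n` gives a bound on tails of `∑ w(D) / D ^ 2`. -/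
lemma sum_div_sq_le {w : ℕ → ℝ} {P : ℝ} (hw : ∀ D, 0 ≤ w D)
    (h : ∀ N : ℕ, ∑ D ∈ Finset.Icc 1 N, w D ≤ N * P) {M : ℕ} (hM : 0 < M) (N : ℕ) :
    ∑ D ∈ Finset.Ioc M N, w D / (D : ℝ) ^ 2 ≤ 2 * P / M := by
  have hP : 0 ≤ P := by
    have := h 1
    simp only [Finset.Icc_self, Finset.sum_singleton, Nat.cast_one, one_mul] at this
    exact (hw 1).trans this
  have hM0 : (0 : ℝ) < M := by exact_mod_cast hM
  rcases le_total N M with hNM | hNM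
  · rw [Finset.Ioc_eq_empty_of_le hNM, Finset.sum_empty]; positivity
  have key : ∑ D ∈ Finset.Ioc M N, w D / (D : ℝ) ^ 2 ≤
      (∑ D ∈ Finset.Icc 1 N, w D) / (N : ℝ) ^ 2 + 2 * P * (1 / M - 1 / N) := by
    induction N, hNM using Nat.le_induction with
    | base =>
      simp only [Finset.Ioc_self, Finset.sum_empty, sub_self, mul_zero, add_zero]
      exact div_nonneg (Finset.sum_nonneg fun D _ => hw D) (sq_nonneg _)
    | succ N hNM ih =>
      have hN0 : (0 : ℝ) < N := by exact_mod_cast hM.trans_le hNM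
      rw [← Finset.insert_Ioc_right_eq_Ioc_add_one hNM, Finset.sum_insert (by simp),
        ← Finset.insert_Icc_right_eq_Icc_add_one (by omega), Finset.sum_insert (by simp)]
      have hA := h N
      set A := ∑ D ∈ Finset.Icc 1 N, w D
      have hdiff : A * (1 / (N : ℝ) ^ 2 - 1 / ((N : ℝ) + 1) ^ 2) ≤
          2 * P * (1 / N - 1 / ((N : ℝ) + 1)) := by
        have h1 : 0 ≤ 1 / (N : ℝ) ^ 2 - 1 / ((N : ℝ) + 1) ^ 2 := by
          rw [sub_nonneg]
          exact one_div_le_one_div_of_le (by positivity) (by nlinarith)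
        refine (mul_le_mul_of_nonneg_right hA h1).trans ?_
        rw [← sub_nonneg]
        have : 2 * P * (1 / N - 1 / ((N : ℝ) + 1)) -
            N * P * (1 / (N : ℝ) ^ 2 - 1 / ((N : ℝ) + 1) ^ 2) = P / (N * ((N : ℝ) + 1) ^ 2) := by
          field_simp
          ring
        rw [this]
        positivity
      push_cast
      have e1 : (w (N + 1) + A) / ((N : ℝ) + 1) ^ 2 =
          w (N + 1) / ((N : ℝ) + 1) ^ 2 + A * (1 / ((N : ℝ) + 1) ^ 2) := by ring
      have e2 : A / (N : ℝ) ^ 2 = A * (1 / (N : ℝ) ^ 2) := by ring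
      rw [e1]
      rw [e2] at ih
      linarith
  have hN0 : (0 : ℝ) < N := by exact_mod_cast hM.trans_le hNM
  have h1 : (∑ D ∈ Finset.Icc 1 N, w D) / (N : ℝ) ^ 2 ≤ P / N := by
    rw [div_le_div_iff₀ (by positivity) hN0]
    nlinarith [h N]
  have h2 : 0 ≤ P / N := by positivity
  have e : 2 * P * (1 / M - 1 / N) = 2 * P / M - 2 * (P / N) := by ring
  linarith

/-- Chebyshev-type bound for the integers `D > M` with `D ^ 2 < y ^ 2 * w D`. -/
lemma tail_finite_and_ncard_le {w : ℕ → ℝ} {P : ℝ} (hw : ∀ D, 0 ≤ w D)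
    (h : ∀ N : ℕ, ∑ D ∈ Finset.Icc 1 N, w D ≤ N * P) {M : ℕ} (hM : 0 < M) (y : ℝ) :
    {D : ℕ | M < D ∧ (D : ℝ) ^ 2 < y ^ 2 * w D}.Finite ∧
      ({D : ℕ | M < D ∧ (D : ℝ) ^ 2 < y ^ 2 * w D}.ncard : ℝ) ≤ y ^ 2 * (2 * P / M) := by
  set A := {D : ℕ | M < D ∧ (D : ℝ) ^ 2 < y ^ 2 * w D}
  have key : ∀ t : Finset ℕ, (t : Set ℕ) ⊆ A → (t.card : ℝ) ≤ y ^ 2 * (2 * P / M) := by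
    intro t ht
    have hsub : t ⊆ Finset.Ioc M (t.sup id) := fun D hD =>
      Finset.mem_Ioc.2 ⟨(ht hD).1, Finset.le_sup (f := id) hD⟩
    calc (t.card : ℝ) = ∑ D ∈ t, (1 : ℝ) := by simp
      _ ≤ ∑ D ∈ t, y ^ 2 * (w D / (D : ℝ) ^ 2) := by
        refine Finset.sum_le_sum fun D hD => ?_
        have hD0 : (0 : ℝ) < D := by exact_mod_cast hM.trans (ht hD).1
        rw [← mul_div_assoc, one_le_div (by positivity)]
        exact (ht hD).2.le
      _ ≤ ∑ D ∈ Finset.Ioc M (t.sup id), y ^ 2 * (w D / (D : ℝ) ^ 2) :=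
        Finset.sum_le_sum_of_subset_of_nonneg hsub fun D _ _ =>
          mul_nonneg (sq_nonneg y) (div_nonneg (hw D) (sq_nonneg _))
      _ ≤ _ := by
        rw [← Finset.mul_sum]
        exact mul_le_mul_of_nonneg_left (sum_div_sq_le hw h hM _) (sq_nonneg y)
  have hfin : A.Finite := by
    by_contra hinf
    obtain ⟨n, hn⟩ := exists_nat_gt (y ^ 2 * (2 * P / M))
    obtain ⟨t, ht, hcard⟩ := Set.Infinite.exists_subset_card_eq hinf n
    have := key t ht
    rw [hcard] at this
    linarith
  refine ⟨hfin, ?_⟩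
  have := key hfin.toFinset (by simp)
  rwa [← Set.ncard_eq_toFinset_card A hfin] at this

lemma progressionSet_restrictOne_empty (f : ℕ → ℝ) (m a : ℕ) (y : ℝ) :
    progressionSet (restrictOne ∅ f) m a y =
      ((Finset.Ico 1 ⌈y⌉₊).filter (fun D => D ≡ a [MOD m]) : Finset ℕ) := by
  ext D
  simp only [progressionSet, oddPrimeProd_restrictOne_empty, Set.mem_ofPred_eq, Finset.coe_filter,
    Finset.mem_Ico, mul_one, Nat.lt_ceil, Nat.succ_le_iff]
  tauto

lemma tendsto_ncard_progressionSet_empty (f : ℕ → ℝ) {m : ℕ} (hm : 0 < m) (a : ℕ) :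
    Tendsto (fun y : ℝ => ((progressionSet (restrictOne ∅ f) m a y).ncard : ℝ) / y) atTop
      (𝓝 (1 / m)) := by
  have hm0 : (0 : ℝ) < m := by exact_mod_cast hm
  have hbound : ∀ y : ℝ, 1 ≤ y →
      |((progressionSet (restrictOne ∅ f) m a y).ncard : ℝ) / y - 1 / m| ≤ 4 / y := by
    intro y hy
    have hy0 : 0 < y := by linarith
    rw [progressionSet_restrictOne_empty, Set.ncard_coe_finset]
    have hcard := Nat.Ico_filter_modEq_card 1 ⌈y⌉₊ hm a
    set c := ((Finset.Ico 1 ⌈y⌉₊).filter (fun D => D ≡ a [MOD m])).card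
    have hc : (1 : ℕ) ≤ ⌈y⌉₊ := Nat.one_le_ceil_iff.2 hy0
    have hle : ⌈(((1 : ℕ) : ℚ) - a) / m⌉ ≤ ⌈((⌈y⌉₊ : ℚ) - a) / m⌉ := by
      apply Int.ceil_mono
      gcongr
    rw [max_eq_left (sub_nonneg.2 hle)] at hcard
    have h1 := Int.le_ceil (((⌈y⌉₊ : ℚ) - a) / m)
    have h2 := Int.ceil_lt_add_one (((⌈y⌉₊ : ℚ) - a) / m)
    have h3 := Int.le_ceil ((((1 : ℕ) : ℚ) - a) / m)
    have h4 := Int.ceil_lt_add_one ((((1 : ℕ) : ℚ) - a) / m)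
    have hcardQ : (c : ℚ) = ⌈((⌈y⌉₊ : ℚ) - a) / m⌉ - ⌈(((1 : ℕ) : ℚ) - a) / m⌉ := by
      exact_mod_cast hcard
    have e : ((⌈y⌉₊ : ℚ) - a) / m - (((1 : ℕ) : ℚ) - a) / m = ((⌈y⌉₊ : ℚ) - 1) / m := by
      push_cast
      ring
    have hlow : ((⌈y⌉₊ : ℚ) - 1) / m - 1 ≤ c := by linarith
    have hupp : (c : ℚ) ≤ ((⌈y⌉₊ : ℚ) - 1) / m + 1 := by linarith
    have hlowR : ((⌈y⌉₊ : ℝ) - 1) / m - 1 ≤ c := by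
      have := (Rat.cast_le (K := ℝ)).2 hlow
      push_cast at this
      exact this
    have huppR : (c : ℝ) ≤ ((⌈y⌉₊ : ℝ) - 1) / m + 1 := by
      have := (Rat.cast_le (K := ℝ)).2 hupp
      push_cast at this
      exact this
    have hc1 := Nat.le_ceil y
    have hc2 := Nat.ceil_lt_add_one hy0.le
    have hm1 : (1 : ℝ) / m ≤ 1 := by
      rw [div_le_one hm0]
      exact_mod_cast hm
    have h5 : (y - 1) / m ≤ ((⌈y⌉₊ : ℝ) - 1) / m := by gcongr
    have h6 : ((⌈y⌉₊ : ℝ) - 1) / m ≤ y / m := by gcongr; linarith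
    have h7 : (y - 1) / m = y / m - 1 / m := by ring
    have e2 : (c : ℝ) / y - 1 / m = (c - y / m) / y := by field_simp
    rw [e2, abs_div, abs_of_pos hy0]
    gcongr
    rw [abs_le]
    constructor <;> linarith
  rw [tendsto_iff_norm_sub_tendsto_zero]
  refine squeeze_zero' (Eventually.of_forall fun _ => norm_nonneg _)
    ((eventually_ge_atTop 1).mono hbound) ?_
  exact tendsto_const_nhds.div_atTop tendsto_id

lemma finite_progressionSet_restrictOne {f : ℕ → ℝ} (S : Finset ℕ)
    (hS : ∀ p ∈ S, p.Prime ∧ p ≠ 2) (m a : ℕ) (y : ℝ) :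
    (progressionSet (restrictOne S f) m a y).Finite := by
  induction S using Finset.induction_on generalizing y with
  | empty => rw [progressionSet_restrictOne_empty]; exact Finset.finite_toSet _
  | insert p S hpS ih =>
    obtain ⟨hp, hp2⟩ := hS p (Finset.mem_insert_self p S)
    have ih' := ih fun q hq => hS q (Finset.mem_insert_of_mem hq)
    refine ((ih' (y * f p)).union (ih' y)).subset ?_
    rintro D ⟨hD, hDa, hlt⟩
    rw [oddPrimeProd_restrictOne_insert f hpS hp hp2 hD.ne'] at hlt
    split_ifs at hlt
    · exact Or.inl ⟨hD, hDa, by rwa [mul_assoc]⟩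
    · exact Or.inr ⟨hD, hDa, by rwa [one_mul] at hlt⟩

/-- Asymptotics of the count when only finitely many primes contribute. -/
lemma tendsto_ncard_progressionSet_restrictOne {f : ℕ → ℝ}
    (hf : ∀ p, p.Prime → p ≠ 2 → 0 < f p) (S : Finset ℕ)
    (hS : ∀ p ∈ S, p.Prime ∧ p ≠ 2) {m : ℕ} (hm : 0 < m) (hmS : ∀ p ∈ S, m.Coprime p) (a : ℕ) :
    Tendsto (fun y : ℝ => ((progressionSet (restrictOne S f) m a y).ncard : ℝ) / y) atTop
      (𝓝 (1 / m * ∏ p ∈ S, (1 - 1 / p + f p / p))) := by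
  induction S using Finset.induction_on generalizing m a with
  | empty => simpa using tendsto_ncard_progressionSet_empty f hm a
  | insert p S hpS ih =>
    obtain ⟨hp, hp2⟩ := hS p (Finset.mem_insert_self p S)
    have hS' : ∀ q ∈ S, q.Prime ∧ q ≠ 2 := fun q hq => hS q (Finset.mem_insert_of_mem hq)
    have hmS' : ∀ q ∈ S, m.Coprime q := fun q hq => hmS q (Finset.mem_insert_of_mem hq)
    have hmp : m.Coprime p := hmS p (Finset.mem_insert_self p S)
    have hp0 : (0 : ℝ) < p := by exact_mod_cast hp.pos
    have hm0 : (0 : ℝ) < m := by exact_mod_cast hm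
    have hfp := hf p hp hp2
    obtain ⟨b, hba, hb0⟩ := Nat.chineseRemainder hmp a 0
    have hb : ∀ D, D ≡ b [MOD m * p] ↔ D ≡ a [MOD m] ∧ p ∣ D := by
      intro D
      rw [← Nat.modEq_and_modEq_iff_modEq_mul hmp, ← Nat.modEq_zero_iff_dvd]
      exact and_congr ⟨fun h => h.trans hba, fun h => h.trans hba.symm⟩
        ⟨fun h => h.trans hb0, fun h => h.trans hb0.symm⟩
    have hcop : ∀ q ∈ S, (m * p).Coprime q := fun q hq =>
      Nat.Coprime.mul_left (hmS' q hq)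
        ((Nat.coprime_primes hp (hS' q hq).1).2 fun h => hpS (h ▸ hq))
    have hident : ∀ y : ℝ,
        ((progressionSet (restrictOne (insert p S) f) m a y).ncard : ℝ) =
          (progressionSet (restrictOne S f) (m * p) b (f p * y)).ncard +
          (progressionSet (restrictOne S f) m a y).ncard -
          (progressionSet (restrictOne S f) (m * p) b y).ncard := by
      intro y
      have hfin := fun m a y => finite_progressionSet_restrictOne (f := f) S hS' m a y
      have hsub : progressionSet (restrictOne S f) (m * p) b y ⊆
          progressionSet (restrictOne S f) m a y :=
        fun D hD => ⟨hD.1, ((hb D).1 hD.2.1).1, hD.2.2⟩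
      have hset : progressionSet (restrictOne (insert p S) f) m a y =
          progressionSet (restrictOne S f) (m * p) b (f p * y) ∪
          (progressionSet (restrictOne S f) m a y \
            progressionSet (restrictOne S f) (m * p) b y) := by
        ext D
        simp only [progressionSet, Set.mem_union, Set.mem_sdiff, Set.mem_ofPred_eq, hb]
        rcases Nat.eq_zero_or_pos D with rfl | hD
        · simp
        rw [oddPrimeProd_restrictOne_insert f hpS hp hp2 hD.ne']
        by_cases hpD : p ∣ D
        · simp only [hpD, if_true, mul_left_comm y, mul_assoc]
          tauto
        · simp only [hpD, if_false, one_mul]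
          tauto
      have hdisj : Disjoint (progressionSet (restrictOne S f) (m * p) b (f p * y))
          (progressionSet (restrictOne S f) m a y \
            progressionSet (restrictOne S f) (m * p) b y) := by
        rw [Set.disjoint_left]
        rintro D h1 ⟨h2, h3⟩
        exact h3 ⟨h1.1, h1.2.1, h2.2.2⟩
      rw [hset, Set.ncard_union_eq hdisj (hfin _ _ _) ((hfin _ _ _).sdiff),
        Set.ncard_sdiff hsub (hfin _ _ _), Nat.cast_add,
        Nat.cast_sub (Set.ncard_le_ncard hsub (hfin _ _ _))]
      ring
    have h1 := ih hS' hm hmS' a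
    have h2 := ih hS' (Nat.mul_pos hm hp.pos) hcop b
    have h3 := (h2.comp (tendsto_id.const_mul_atTop hfp)).const_mul (f p)
    have h4 := (h3.add h1).sub h2
    rw [Finset.prod_insert hpS]
    convert h4 using 2 with y
    · rw [hident, sub_div, add_div]
      simp only [Function.comp, id]
      congr 2
      rw [mul_div_assoc', mul_div_mul_left _ _ hfp.ne']
    · push_cast
      field_simp
      ring

/-- The local factor of `D / F D`. -/
noncomputable def invFactor (p : ℕ) : ℝ := (1 + (leg p : ℝ) / p)⁻¹

/-- A majorant of `invFactor`, independent of the Legendre symbol. -/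
noncomputable def majorant (p : ℕ) : ℝ := (1 - 1 / (p : ℝ))⁻¹

/-- A majorant of the square of `majorant`, convenient for averaging. -/
noncomputable def sqMajorant (p : ℕ) : ℝ := 1 + 4 / (p : ℝ)

/-- The function equal to `1` on `S` and to `f` elsewhere. -/
noncomputable def oneOn (S : Finset ℕ) (f : ℕ → ℝ) (p : ℕ) : ℝ :=
  if p ∈ S then 1 else f p

/-- The odd primes less than `n`. -/
def oddPrimesBelow (n : ℕ) : Finset ℕ :=
  (Finset.range n).filter fun p => p.Prime ∧ p ≠ 2

/-- The summand controlling the mean of `sqMajorant`, extended by zero. -/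
noncomputable def meanTerm (p : ℕ) : ℝ := if p.Prime ∧ p ≠ 2 then 4 / (p : ℝ) ^ 2 else 0

/-- The tail of the series `∑ meanTerm p`. -/
noncomputable def meanTail (n : ℕ) : ℝ := ∑' p, meanTerm p - ∑ p ∈ Finset.range n, meanTerm p

lemma three_le_of_odd_prime {p : ℕ} (hp : p.Prime) (hp2 : p ≠ 2) : (3 : ℝ) ≤ p := by
  have := hp.two_le
  exact_mod_cast (by omega : 3 ≤ p)

lemma leg_eq_one_or_neg_one {p : ℕ} (hp : p.Prime) (hp2 : p ≠ 2) : leg p = 1 ∨ leg p = -1 := by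
  have : Fact p.Prime := ⟨hp⟩
  rw [leg, dif_pos hp]
  refine legendreSym.eq_one_or_neg_one p ?_
  rw [Ne, ZMod.intCast_zmod_eq_zero_iff_dvd]
  intro h
  have h' : p ∣ 2 := by exact_mod_cast (dvd_neg.1 h)
  exact hp2 ((Nat.prime_dvd_prime_iff_eq hp Nat.prime_two).1 h')

lemma one_le_majorant {p : ℕ} (hp : p.Prime) (hp2 : p ≠ 2) : 1 ≤ majorant p := by
  have := three_le_of_odd_prime hp hp2
  have h1 : 1 / (p : ℝ) ≤ 1 / 3 := one_div_le_one_div_of_le (by norm_num) this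
  have h2 : 0 < 1 / (p : ℝ) := by positivity
  exact (one_le_inv₀ (by linarith)).2 (by linarith)

lemma majorant_mul_self_le {p : ℕ} (hp : p.Prime) (hp2 : p ≠ 2) :
    majorant p * majorant p ≤ sqMajorant p := by
  have h3 := three_le_of_odd_prime hp hp2
  have e : majorant p = p / (p - 1) := by
    have : (p : ℝ) - 1 ≠ 0 := by linarith
    rw [majorant]
    field_simp
  have e' : sqMajorant p = (p + 4) / p := by
    rw [sqMajorant]
    field_simp
  rw [e, e', div_mul_div_comm, div_le_div_iff₀ (by nlinarith) (by linarith)]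
  nlinarith

lemma majorant_le_sqMajorant {p : ℕ} (hp : p.Prime) (hp2 : p ≠ 2) :
    majorant p ≤ sqMajorant p := by
  have h1 := one_le_majorant hp hp2
  have h2 := majorant_mul_self_le hp hp2
  nlinarith

lemma one_le_sqMajorant (p : ℕ) : 1 ≤ sqMajorant p := by
  rw [sqMajorant]
  have : 0 ≤ 4 / (p : ℝ) := by positivity
  linarith

lemma one_sub_le_one_add_leg {p : ℕ} (hp : p.Prime) (hp2 : p ≠ 2) :
    1 - 1 / (p : ℝ) ≤ 1 + (leg p : ℝ) / p ∧ 1 + (leg p : ℝ) / p ≤ 1 + 1 / (p : ℝ) := by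
  have h2 : 0 < 1 / (p : ℝ) := one_div_pos.2 (by exact_mod_cast hp.pos)
  rcases leg_eq_one_or_neg_one hp hp2 with h | h <;> rw [h] <;> push_cast
  · constructor <;> linarith
  · rw [neg_div]
    constructor <;> linarith

lemma one_sub_inv_pos {p : ℕ} (hp : p.Prime) : 0 < 1 - 1 / (p : ℝ) := by
  rw [sub_pos, div_lt_one (by exact_mod_cast hp.pos)]
  exact_mod_cast hp.one_lt

lemma invFactor_pos {p : ℕ} (hp : p.Prime) (hp2 : p ≠ 2) : 0 < invFactor p :=
  inv_pos.2 ((one_sub_inv_pos hp).trans_le (one_sub_le_one_add_leg hp hp2).1)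

lemma invFactor_le_majorant {p : ℕ} (hp : p.Prime) (hp2 : p ≠ 2) : invFactor p ≤ majorant p :=
  inv_anti₀ (one_sub_inv_pos hp) (one_sub_le_one_add_leg hp hp2).1

lemma one_le_invFactor_mul_majorant {p : ℕ} (hp : p.Prime) (hp2 : p ≠ 2) :
    1 ≤ invFactor p * majorant p := by
  have h := one_sub_le_one_add_leg hp hp2
  have h0 := one_sub_inv_pos hp
  have h1 : 0 < 1 + (leg p : ℝ) / p := h0.trans_le h.1
  rw [invFactor, majorant, ← mul_inv, one_le_inv₀ (mul_pos h1 h0)]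
  calc _ ≤ (1 + 1 / (p : ℝ)) * (1 - 1 / p) := mul_le_mul_of_nonneg_right h.2 h0.le
    _ = 1 - (1 / (p : ℝ)) ^ 2 := by ring
    _ ≤ 1 := by linarith [sq_nonneg (1 / (p : ℝ))]

lemma F_lt_iff {D : ℕ} (y : ℝ) : F D < y ↔ (D : ℝ) < y * oddPrimeProd invFactor D := by
  have hpos : 0 < oddPrimeProd invFactor D := oddPrimeProd_pos (fun _ => invFactor_pos) D
  have : F D = D / oddPrimeProd invFactor D := by
    simp only [F, oddPrimeProd, invFactor, Finset.prod_inv_distrib, div_inv_eq_mul]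
  rw [this, div_lt_iff₀ hpos]

lemma oddPrimeProd_eq_restrictOne_mul_oneOn (f : ℕ → ℝ) (S : Finset ℕ) (D : ℕ) :
    oddPrimeProd f D = oddPrimeProd (restrictOne S f) D * oddPrimeProd (oneOn S f) D := by
  rw [← oddPrimeProd_mul]
  congr 1
  funext p
  simp only [restrictOne, oneOn]
  split_ifs <;> simp

lemma meanTerm_nonneg (p : ℕ) : 0 ≤ meanTerm p := by
  rw [meanTerm]
  split_ifs <;> positivity

lemma summable_meanTerm : Summable meanTerm := by
  have h : Summable fun n : ℕ => 4 * (1 / (n : ℝ) ^ 2) :=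
    (Real.summable_one_div_nat_pow.2 one_lt_two).mul_left 4
  refine Summable.of_nonneg_of_le meanTerm_nonneg (fun p => ?_) h
  rw [meanTerm]
  split_ifs
  · exact le_of_eq (by ring)
  · positivity

lemma tendsto_meanTail : Tendsto meanTail atTop (𝓝 0) := by
  have := summable_meanTerm.hasSum.tendsto_sum_nat.const_sub (∑' p, meanTerm p)
  rwa [sub_self] at this

lemma oddPrimeProd_restrictOne_oddPrimesBelow (f : ℕ → ℝ) {D N : ℕ} (hD : 0 < D) (h : D ≤ N) :
    oddPrimeProd (restrictOne (oddPrimesBelow (N + 1)) f) D = oddPrimeProd f D := by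
  refine Finset.prod_congr rfl fun p hp => ?_
  have hle : p ≤ D := Nat.le_of_dvd hD (Nat.dvd_of_mem_primeFactors (Finset.mem_filter.1 hp).1)
  rw [restrictOne, if_pos]
  rw [oddPrimesBelow, Finset.mem_filter, Finset.mem_range]
  exact ⟨by omega, mem_oddPrimes_s19 hp⟩

/-- Mean value of the part of `sqMajorant` supported on primes that are at least `n`. -/
lemma sum_oneOn_sqMajorant_le (n N : ℕ) :
    ∑ D ∈ Finset.Icc 1 N, oddPrimeProd (oneOn (oddPrimesBelow n) sqMajorant) D ≤
      N * Real.exp (meanTail n) := by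
  set f := oneOn (oddPrimesBelow n) sqMajorant with hfdef
  have hf : ∀ p, 1 ≤ f p := fun p => by
    rw [hfdef, oneOn]
    split_ifs
    exacts [le_rfl, one_le_sqMajorant p]
  set T := oddPrimesBelow (N + 1)
  have hT : ∀ p ∈ T, p.Prime ∧ p ≠ 2 := fun p hp => (Finset.mem_filter.1 hp).2
  have hterm : ∀ p ∈ T, (f p - 1) / p ≤ if p ∈ Finset.range n then 0 else meanTerm p := by
    intro p hp
    have hpp := hT p hp
    have hmem : p ∈ oddPrimesBelow n ↔ p ∈ Finset.range n := by
      simp [oddPrimesBelow, hpp.1, hpp.2]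
    rw [hfdef, oneOn, meanTerm, if_pos hpp]
    simp only [hmem]
    split_ifs
    · simp
    · exact le_of_eq (by rw [sqMajorant]; ring)
  have hsum : ∑ p ∈ T, (f p - 1) / p ≤ meanTail n := by
    calc _ ≤ ∑ p ∈ T, (if p ∈ Finset.range n then 0 else meanTerm p) := Finset.sum_le_sum hterm
      _ = ∑ p ∈ T \ Finset.range n, meanTerm p := by
        rw [Finset.sdiff_eq_filter, Finset.sum_filter]
        simp only [ite_not]
      _ ≤ meanTail n := by
        rw [meanTail, le_sub_iff_add_le, ← Finset.sum_union Finset.sdiff_disjoint]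
        exact summable_meanTerm.sum_le_tsum _ fun p _ => meanTerm_nonneg p
  calc _ = ∑ D ∈ Finset.Icc 1 N, oddPrimeProd (restrictOne T f) D := by
        refine Finset.sum_congr rfl fun D hD => ?_
        rw [Finset.mem_Icc] at hD
        exact (oddPrimeProd_restrictOne_oddPrimesBelow f hD.1 hD.2).symm
    _ ≤ N * ∏ p ∈ T, (1 + (f p - 1) / p) := sum_oddPrimeProd_restrictOne_le hf T hT N
    _ ≤ N * ∏ p ∈ T, Real.exp ((f p - 1) / p) := by
        refine mul_le_mul_of_nonneg_left (Finset.prod_le_prod (fun p _ => ?_) fun p _ => ?_)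
          (Nat.cast_nonneg N)
        · exact add_nonneg zero_le_one (div_nonneg (sub_nonneg.2 (hf p)) (Nat.cast_nonneg p))
        · rw [add_comm]
          exact Real.add_one_le_exp _
    _ ≤ _ := by
        rw [← Real.exp_sum]
        exact mul_le_mul_of_nonneg_left (Real.exp_le_exp.2 hsum) (Nat.cast_nonneg N)

lemma oneOn_oddPrimesBelow_zero (f : ℕ → ℝ) : oneOn (oddPrimesBelow 0) f = f := by
  funext p
  simp [oneOn, oddPrimesBelow]

lemma sum_sqMajorant_le (N : ℕ) :
    ∑ D ∈ Finset.Icc 1 N, oddPrimeProd sqMajorant D ≤ N * Real.exp (meanTail 0) := by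
  simpa only [oneOn_oddPrimesBelow_zero] using sum_oneOn_sqMajorant_le 0 N

/-- The integers below `y * ∏ majorant p` whose prime factors `≥ n` contribute a factor
exceeding `1 + ε`. -/
def exceptionalSet (n : ℕ) (ε y : ℝ) : Set ℕ :=
  {D | 0 < D ∧ (D : ℝ) < y * oddPrimeProd majorant D ∧
    1 + ε < oddPrimeProd (oneOn (oddPrimesBelow n) majorant) D}

lemma sq_lt_of_lt_majorant {D : ℕ} {y : ℝ}
    (h : (D : ℝ) < y * oddPrimeProd majorant D) :
    (D : ℝ) ^ 2 < y ^ 2 * oddPrimeProd sqMajorant D := by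
  have h1 : oddPrimeProd majorant D * oddPrimeProd majorant D ≤ oddPrimeProd sqMajorant D := by
    rw [← oddPrimeProd_mul]
    exact oddPrimeProd_mono (fun p _ _ => mul_self_nonneg _) (fun p => majorant_mul_self_le) D
  calc (D : ℝ) ^ 2 < (y * oddPrimeProd majorant D) ^ 2 :=
        pow_lt_pow_left₀ h (Nat.cast_nonneg D) two_ne_zero
    _ = y ^ 2 * (oddPrimeProd majorant D * oddPrimeProd majorant D) := by ring
    _ ≤ _ := mul_le_mul_of_nonneg_left h1 (sq_nonneg y)

lemma oddPrimeProd_sqMajorant_nonneg (D : ℕ) : 0 ≤ oddPrimeProd sqMajorant D :=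
  zero_le_one.trans (one_le_oddPrimeProd (fun p _ _ => one_le_sqMajorant p) D)

lemma finite_lt_majorant (y : ℝ) : {D : ℕ | (D : ℝ) < y * oddPrimeProd majorant D}.Finite := by
  have h := (tail_finite_and_ncard_le oddPrimeProd_sqMajorant_nonneg sum_sqMajorant_le
    one_pos y).1
  refine (h.union (Set.finite_Iic 1)).subset fun D hD => ?_
  rcases lt_or_ge 1 D with h1 | h1
  · exact Or.inl ⟨h1, sq_lt_of_lt_majorant hD⟩
  · exact Or.inr h1

lemma finite_exceptionalSet (n : ℕ) (ε y : ℝ) : (exceptionalSet n ε y).Finite :=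
  (finite_lt_majorant y).subset fun _ hD => hD.2.1

lemma ncard_exceptionalSet_le (n : ℕ) {ε y K : ℝ} (hε : 0 < ε) (hK : 0 < K) (hy : 1 ≤ y) :
    ((exceptionalSet n ε y).ncard : ℝ) ≤
      y * ((K + 1) * (Real.exp (meanTail n) - 1) / ε + 2 * Real.exp (meanTail 0) / K) := by
  have hy0 : 0 < y := by linarith
  set M := ⌈K * y⌉₊ with hMdef
  have hM : 0 < M := Nat.ceil_pos.2 (mul_pos hK hy0)
  have hM0 : (0 : ℝ) < M := by exact_mod_cast hM
  have hM1 : K * y ≤ M := Nat.le_ceil _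
  have hM2 : (M : ℝ) ≤ (K + 1) * y := by
    have := (Nat.ceil_lt_add_one (mul_pos hK hy0).le).le
    linarith
  set f := oneOn (oddPrimesBelow n) sqMajorant with hfdef
  have hf : ∀ p, 1 ≤ f p := fun p => by
    rw [hfdef, oneOn]
    split_ifs
    exacts [le_rfl, one_le_sqMajorant p]
  obtain ⟨hfin, hcard⟩ := tail_finite_and_ncard_le oddPrimeProd_sqMajorant_nonneg
    sum_sqMajorant_le hM y
  set A := (Finset.Icc 1 M).filter fun D => 1 + ε < oddPrimeProd f D
  have hsub : exceptionalSet n ε y ⊆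
      (A : Set ℕ) ∪ {D : ℕ | M < D ∧ (D : ℝ) ^ 2 < y ^ 2 * oddPrimeProd sqMajorant D} := by
    rintro D ⟨hD, h1, h2⟩
    rcases lt_or_ge M D with h3 | h3
    · exact Or.inr ⟨h3, sq_lt_of_lt_majorant h1⟩
    · refine Or.inl (Finset.mem_coe.2 (Finset.mem_filter.2 ⟨Finset.mem_Icc.2 ⟨hD, h3⟩, ?_⟩))
      refine h2.trans_le (oddPrimeProd_mono (fun p hp hp2 => ?_) (fun p hp hp2 => ?_) D)
      · rw [oneOn]
        split_ifs
        exacts [zero_le_one, zero_le_one.trans (one_le_majorant hp hp2)]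
      · rw [hfdef, oneOn, oneOn]
        split_ifs
        exacts [le_rfl, majorant_le_sqMajorant hp hp2]
  have hA : (A.card : ℝ) * ε ≤ M * (Real.exp (meanTail n) - 1) := by
    calc (A.card : ℝ) * ε = ∑ D ∈ A, ε := by simp
      _ ≤ ∑ D ∈ A, (oddPrimeProd f D - 1) :=
        Finset.sum_le_sum fun D hD => by linarith [(Finset.mem_filter.1 hD).2]
      _ ≤ ∑ D ∈ Finset.Icc 1 M, (oddPrimeProd f D - 1) :=
        Finset.sum_le_sum_of_subset_of_nonneg (Finset.filter_subset _ _) fun D _ _ =>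
          sub_nonneg.2 (one_le_oddPrimeProd (fun p _ _ => hf p) D)
      _ ≤ _ := by
        rw [Finset.sum_sub_distrib, mul_sub]
        have := sum_oneOn_sqMajorant_le n M
        simpa using this
  have hE : 0 ≤ Real.exp (meanTail n) - 1 := by
    have : 0 ≤ (M : ℝ) * (Real.exp (meanTail n) - 1) := le_trans (by positivity) hA
    exact nonneg_of_mul_nonneg_right this hM0
  have hA' : (A.card : ℝ) ≤ y * ((K + 1) * (Real.exp (meanTail n) - 1) / ε) := by
    rw [mul_div_assoc', le_div_iff₀ hε]
    refine hA.trans ((mul_le_mul_of_nonneg_right hM2 hE).trans (le_of_eq (by ring)))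
  have hB : y ^ 2 * (2 * Real.exp (meanTail 0) / M) ≤ y * (2 * Real.exp (meanTail 0) / K) := by
    calc _ ≤ y ^ 2 * (2 * Real.exp (meanTail 0) / (K * y)) := by gcongr
      _ = _ := by field_simp
  have h1 := (Set.ncard_le_ncard hsub ((Finset.finite_toSet A).union hfin)).trans
    (Set.ncard_union_le _ _)
  rw [Set.ncard_coe_finset] at h1
  have h2 : ((exceptionalSet n ε y).ncard : ℝ) ≤ A.card +
      ({D : ℕ | M < D ∧ (D : ℝ) ^ 2 < y ^ 2 * oddPrimeProd sqMajorant D}.ncard : ℝ) := by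
    exact_mod_cast h1
  rw [mul_add]
  linarith

lemma progressionSet_invFactor_subset (n m a : ℕ) {ε y : ℝ} (hy : 0 < y) :
    progressionSet invFactor m a y ⊆
      progressionSet (restrictOne (oddPrimesBelow n) invFactor) m a ((1 + ε) * y) ∪
        exceptionalSet n ε y := by
  rintro D ⟨hD, hDa, hlt⟩
  by_cases hr : 1 + ε < oddPrimeProd (oneOn (oddPrimesBelow n) majorant) D
  · refine Or.inr ⟨hD, hlt.trans_le (mul_le_mul_of_nonneg_left ?_ hy.le), hr⟩
    exact oddPrimeProd_mono (fun p hp hp2 => (invFactor_pos hp hp2).le)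
      (fun p => invFactor_le_majorant) D
  · refine Or.inl ⟨hD, hDa, hlt.trans_le ?_⟩
    have h1 : oddPrimeProd (oneOn (oddPrimesBelow n) invFactor) D ≤ 1 + ε := by
      refine le_trans (oddPrimeProd_mono (fun p hp hp2 => ?_) (fun p hp hp2 => ?_) D)
        (not_lt.1 hr)
      · rw [oneOn]
        split_ifs
        exacts [zero_le_one, (invFactor_pos hp hp2).le]
      · rw [oneOn, oneOn]
        split_ifs
        exacts [le_rfl, invFactor_le_majorant hp hp2]
    have h2 : 0 ≤ oddPrimeProd (restrictOne (oddPrimesBelow n) invFactor) D := by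
      refine (oddPrimeProd_pos (fun p hp hp2 => ?_) D).le
      rw [restrictOne]
      split_ifs
      exacts [invFactor_pos hp hp2, one_pos]
    rw [oddPrimeProd_eq_restrictOne_mul_oneOn invFactor (oddPrimesBelow n)]
    calc _ = oddPrimeProd (oneOn (oddPrimesBelow n) invFactor) D *
          (y * oddPrimeProd (restrictOne (oddPrimesBelow n) invFactor) D) := by ring
      _ ≤ (1 + ε) * (y * oddPrimeProd (restrictOne (oddPrimesBelow n) invFactor) D) :=
        mul_le_mul_of_nonneg_right h1 (mul_nonneg hy.le h2)
      _ = _ := by ring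

lemma progressionSet_restrictOne_subset (n m a : ℕ) {ε y : ℝ} (hε : 0 < ε) (hy : 0 < y) :
    progressionSet (restrictOne (oddPrimesBelow n) invFactor) m a ((1 + ε)⁻¹ * y) ⊆
      progressionSet invFactor m a y ∪ exceptionalSet n ε y := by
  rintro D ⟨hD, hDa, hlt⟩
  have h2 : 0 ≤ oddPrimeProd (restrictOne (oddPrimesBelow n) invFactor) D := by
    refine (oddPrimeProd_pos (fun p hp hp2 => ?_) D).le
    rw [restrictOne]
    split_ifs
    exacts [invFactor_pos hp hp2, one_pos]
  have hε1 : (0 : ℝ) < 1 + ε := by linarith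
  by_cases hr : 1 + ε < oddPrimeProd (oneOn (oddPrimesBelow n) majorant) D
  · refine Or.inr ⟨hD, hlt.trans_le (mul_le_mul ?_ ?_ h2 hy.le), hr⟩
    · exact mul_le_of_le_one_left hy.le (inv_le_one_of_one_le₀ (by linarith))
    · refine oddPrimeProd_mono (fun p hp hp2 => ?_) (fun p hp hp2 => ?_) D
      · rw [restrictOne]
        split_ifs
        exacts [(invFactor_pos hp hp2).le, zero_le_one]
      · rw [restrictOne]
        split_ifs
        exacts [invFactor_le_majorant hp hp2, one_le_majorant hp hp2]
  · refine Or.inl ⟨hD, hDa, hlt.trans_le ?_⟩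
    have h1 : 1 ≤ oddPrimeProd (oneOn (oddPrimesBelow n) invFactor) D * (1 + ε) := by
      have hpos : 0 ≤ oddPrimeProd (oneOn (oddPrimesBelow n) invFactor) D := by
        refine (oddPrimeProd_pos (fun p hp hp2 => ?_) D).le
        rw [oneOn]
        split_ifs
        exacts [one_pos, invFactor_pos hp hp2]
      refine le_trans ?_ (mul_le_mul_of_nonneg_left (not_lt.1 hr) hpos)
      rw [← oddPrimeProd_mul]
      refine one_le_oddPrimeProd (fun p hp hp2 => ?_) D
      simp only [oneOn]
      split_ifs
      exacts [(one_mul (1 : ℝ)).ge, one_le_invFactor_mul_majorant hp hp2]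
    have h3 : (1 + ε)⁻¹ ≤ oddPrimeProd (oneOn (oddPrimesBelow n) invFactor) D := by
      rwa [inv_le_iff_one_le_mul₀ hε1]
    rw [oddPrimeProd_eq_restrictOne_mul_oneOn invFactor (oddPrimesBelow n)]
    calc _ = (1 + ε)⁻¹ * (y * oddPrimeProd (restrictOne (oddPrimesBelow n) invFactor) D) := by
          ring
      _ ≤ oddPrimeProd (oneOn (oddPrimesBelow n) invFactor) D *
          (y * oddPrimeProd (restrictOne (oddPrimesBelow n) invFactor) D) :=
        mul_le_mul_of_nonneg_right h3 (mul_nonneg hy.le h2)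
      _ = _ := by ring

lemma finite_progressionSet_invFactor (m a : ℕ) (y : ℝ) :
    (progressionSet invFactor m a y).Finite := by
  rcases le_or_gt y 0 with hy | hy
  · convert Set.finite_empty
    refine Set.eq_empty_iff_forall_notMem.2 fun D hD => ?_
    have h1 := mul_nonpos_of_nonpos_of_nonneg hy
      (oddPrimeProd_pos (fun _ => invFactor_pos) D).le
    exact absurd (hD.2.2.trans_le h1) (not_lt.2 (Nat.cast_nonneg D))
  · refine (finite_lt_majorant y).subset fun D hD =>
      hD.2.2.trans_le (mul_le_mul_of_nonneg_left ?_ hy.le)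
    exact oddPrimeProd_mono (fun p hp hp2 => (invFactor_pos hp hp2).le)
      (fun p => invFactor_le_majorant) D

lemma tendsto_prod_oddPrimesBelow :
    Tendsto (fun n => ∏ p ∈ oddPrimesBelow n, (1 - 1 / (p : ℝ) + invFactor p / p)) atTop
      (𝓝 Cconst) := by
  set g : ℕ → ℝ := fun p => if p.Prime ∧ p ≠ 2 then (invFactor p - 1) / p else 0 with hg
  have hbound : ∀ p, ‖g p‖ ≤ meanTerm p := by
    intro p
    simp only [hg, meanTerm]
    split_ifs with h
    · have hp0 : (0 : ℝ) < p := by exact_mod_cast h.1.pos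
      have h1 := invFactor_le_majorant h.1 h.2
      have h2 := majorant_le_sqMajorant h.1 h.2
      have h3 := one_le_invFactor_mul_majorant h.1 h.2
      have h4 : 1 - 1 / (p : ℝ) ≤ invFactor p := by
        rwa [majorant, ← div_eq_mul_inv, one_le_div (one_sub_inv_pos h.1)] at h3
      have h5 : (4 : ℝ) / p = 4 * (1 / p) := by ring
      have h6 : 0 < 1 / (p : ℝ) := by positivity
      rw [sqMajorant] at h2
      rw [norm_div, Real.norm_eq_abs, Real.norm_eq_abs, abs_of_pos hp0, div_le_iff₀ hp0]
      have e : 4 / (p : ℝ) ^ 2 * p = 4 / p := by field_simp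
      rw [e, abs_le]
      constructor <;> linarith
    · simp
  have hmul : Multipliable fun p => 1 + g p :=
    Real.multipliable_one_add_of_summable (Summable.of_norm_bounded summable_meanTerm hbound)
  have hC : Cconst = ∏' p, (1 + g p) := by
    have h1 := tprod_subtype {p : ℕ | p.Prime ∧ p ≠ 2} (fun p => 1 + g p)
    have h2 : Set.mulIndicator {p : ℕ | p.Prime ∧ p ≠ 2} (fun p => 1 + g p) =
        fun p => 1 + g p := by
      rw [Set.mulIndicator_eq_self]
      intro p hp
      by_contra h
      have h' : ¬(p.Prime ∧ p ≠ 2) := h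
      exact hp (by simp only [hg]; rw [if_neg h', add_zero])
    rw [h2] at h1
    rw [← h1, Cconst]
    refine tprod_congr fun p => ?_
    have hp0 : (p.1 : ℝ) ≠ 0 := by exact_mod_cast p.2.1.ne_zero
    have h3 : 1 / ((p.1 : ℝ) + leg p.1) = invFactor p.1 / p.1 := by
      rw [invFactor, inv_eq_one_div, div_div, add_mul, one_mul, div_mul_cancel₀ _ hp0]
    simp only [hg]
    rw [if_pos p.2, h3]
    ring
  rw [hC]
  convert hmul.hasProd.tendsto_prod_nat using 2 with n
  rw [oddPrimesBelow, Finset.prod_filter]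
  refine Finset.prod_congr rfl fun p _ => ?_
  simp only [hg]
  split_ifs <;> ring

/-- The integers `D ≡ a (mod m)` with `D < y * ∏ invFactor p` have the expected density when `m`
is coprime to all odd primes. -/
lemma tendsto_ncard_progressionSet_invFactor {m : ℕ} (hm : 0 < m)
    (hmp : ∀ p, p.Prime → p ≠ 2 → m.Coprime p) (a : ℕ) :
    Tendsto (fun y : ℝ => ((progressionSet invFactor m a y).ncard : ℝ) / y) atTop
      (𝓝 (1 / m * Cconst)) := by
  set c : ℝ := 1 / m * Cconst
  set cn : ℕ → ℝ := fun n =>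
    1 / m * ∏ p ∈ oddPrimesBelow n, (1 - 1 / (p : ℝ) + invFactor p / p)
  have hcn : Tendsto cn atTop (𝓝 c) := tendsto_prod_oddPrimesBelow.const_mul _
  have hodd : ∀ n, ∀ p ∈ oddPrimesBelow n, p.Prime ∧ p ≠ 2 := fun n p hp =>
    (Finset.mem_filter.1 hp).2
  have htrunc : ∀ n t, 0 < t → Tendsto (fun y : ℝ =>
      ((progressionSet (restrictOne (oddPrimesBelow n) invFactor) m a (t * y)).ncard : ℝ) / y)
      atTop (𝓝 (t * cn n)) := by
    intro n t ht
    have h := tendsto_ncard_progressionSet_restrictOne (fun _ => invFactor_pos)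
      (oddPrimesBelow n) (hodd n) hm (fun p hp => hmp p (hodd n p hp).1 (hodd n p hp).2) a
    refine ((h.comp (tendsto_id.const_mul_atTop ht)).const_mul t).congr fun y => ?_
    simp only [Function.comp, id]
    rw [mul_div_assoc', mul_div_mul_left _ _ ht.ne']
  set R : ℝ → ℝ → ℕ → ℝ := fun ε K n =>
    (K + 1) * (Real.exp (meanTail n) - 1) / ε + 2 * Real.exp (meanTail 0) / K
  have hR : ∀ ε K, Tendsto (R ε K) atTop (𝓝 (2 * Real.exp (meanTail 0) / K)) := by
    intro ε K
    have h1 : Tendsto (fun n => Real.exp (meanTail n) - 1) atTop (𝓝 0) := by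
      simpa using ((Real.continuous_exp.tendsto 0).comp tendsto_meanTail).sub_const 1
    simpa using ((h1.const_mul (K + 1)).div_const ε).add_const (2 * Real.exp (meanTail 0) / K)
  have hK : Tendsto (fun K : ℝ => 2 * Real.exp (meanTail 0) / K) atTop (𝓝 0) :=
    tendsto_const_nhds.div_atTop tendsto_id
  have hupper : ∀ n {ε K y : ℝ}, 0 < ε → 0 < K → 1 ≤ y →
      ((progressionSet invFactor m a y).ncard : ℝ) / y ≤
        ((progressionSet (restrictOne (oddPrimesBelow n) invFactor) m a
          ((1 + ε) * y)).ncard : ℝ) / y + R ε K n := by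
    intro n ε K y hε hK hy
    have hy0 : 0 < y := by linarith
    have h1 := (Set.ncard_le_ncard (progressionSet_invFactor_subset n m a (ε := ε) hy0)
      ((finite_progressionSet_restrictOne _ (hodd n) _ _ _).union
        (finite_exceptionalSet _ _ _))).trans (Set.ncard_union_le _ _)
    have h2 := ncard_exceptionalSet_le n hε hK hy
    rw [div_le_iff₀ hy0, add_mul, div_mul_cancel₀ _ hy0.ne', mul_comm (R ε K n)]
    exact le_trans (by exact_mod_cast h1) (add_le_add_right h2 _)
  have hlower : ∀ n {ε K y : ℝ}, 0 < ε → 0 < K → 1 ≤ y →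
      ((progressionSet (restrictOne (oddPrimesBelow n) invFactor) m a
          ((1 + ε)⁻¹ * y)).ncard : ℝ) / y ≤
        ((progressionSet invFactor m a y).ncard : ℝ) / y + R ε K n := by
    intro n ε K y hε hK hy
    have hy0 : 0 < y := by linarith
    have h1 := (Set.ncard_le_ncard (progressionSet_restrictOne_subset n m a hε hy0)
      ((finite_progressionSet_invFactor _ _ _).union
        (finite_exceptionalSet _ _ _))).trans (Set.ncard_union_le _ _)
    have h2 := ncard_exceptionalSet_le n hε hK hy
    rw [div_le_iff₀ hy0, add_mul, div_mul_cancel₀ _ hy0.ne', mul_comm (R ε K n)]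
    exact le_trans (by exact_mod_cast h1) (add_le_add_right h2 _)
  refine tendsto_order.2 ⟨fun c' hc' => ?_, fun c' hc' => ?_⟩
  · have hε : Tendsto (fun ε : ℝ => (1 + ε)⁻¹ * c) (𝓝[>] 0) (𝓝 c) := by
      have : ContinuousAt (fun ε : ℝ => (1 + ε)⁻¹ * c) 0 :=
        ((continuousAt_const.add continuousAt_id).inv₀ (by simp)).mul continuousAt_const
      have h := this.tendsto.mono_left (nhdsWithin_le_nhds (s := Set.Ioi 0))
      simpa using h
    obtain ⟨ε, hεc, hε0⟩ :=
      ((hε.eventually_const_lt hc').and self_mem_nhdsWithin).exists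
    have hε1 : (0 : ℝ) < (1 + ε)⁻¹ := inv_pos.2 (by have : 0 < ε := hε0; linarith)
    obtain ⟨K, hKc, hK0⟩ := (((hK.const_sub ((1 + ε)⁻¹ * c)).eventually_const_lt
      (by simpa using hεc)).and (eventually_gt_atTop 0)).exists
    obtain ⟨n, hn⟩ := (((hcn.const_mul (1 + ε)⁻¹).sub (hR ε K)).eventually_const_lt hKc).exists
    filter_upwards [((htrunc n _ hε1).sub_const (R ε K n)).eventually_const_lt hn,
      eventually_ge_atTop 1] with y hy hy1
    linarith [hlower n hε0 hK0 hy1]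
  · have hε : Tendsto (fun ε : ℝ => (1 + ε) * c) (𝓝[>] 0) (𝓝 c) := by
      have : ContinuousAt (fun ε : ℝ => (1 + ε) * c) 0 :=
        (continuousAt_const.add continuousAt_id).mul continuousAt_const
      have h := this.tendsto.mono_left (nhdsWithin_le_nhds (s := Set.Ioi 0))
      simpa using h
    obtain ⟨ε, hεc, hε0⟩ :=
      ((hε.eventually_lt_const hc').and self_mem_nhdsWithin).exists
    have hε1 : (0 : ℝ) < 1 + ε := by have : 0 < ε := hε0; linarith
    obtain ⟨K, hKc, hK0⟩ := (((hK.const_add ((1 + ε) * c)).eventually_lt_const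
      (by simpa using hεc)).and (eventually_gt_atTop 0)).exists
    obtain ⟨n, hn⟩ := (((hcn.const_mul (1 + ε)).add (hR ε K)).eventually_lt_const hKc).exists
    filter_upwards [((htrunc n _ hε1).add_const (R ε K n)).eventually_lt_const hn,
      eventually_ge_atTop 1] with y hy hy1
    linarith [hupper n hε0 hK0 hy1]

lemma setOf_F_lt_eq_progressionSet {m a : ℕ} (ham : a < m) {c : ℝ} (hc : 0 < c) (x : ℝ) :
    {D : ℕ | 0 < D ∧ D % m = a ∧ c * F D < x} = progressionSet invFactor m a (x / c) := by
  ext D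
  simp only [progressionSet, Set.mem_ofPred_eq, Nat.ModEq, Nat.mod_eq_of_lt ham, ← F_lt_iff,
    lt_div_iff₀' hc]

lemma tendsto_ncard_progressionSet_div {m : ℕ} (hm : 0 < m)
    (hmp : ∀ p, p.Prime → p ≠ 2 → m.Coprime p) (a : ℕ) {c : ℝ} (hc : 0 < c) :
    Tendsto (fun x : ℝ => ((progressionSet invFactor m a (x / c)).ncard : ℝ) / x) atTop
      (𝓝 (1 / (m * c) * Cconst)) := by
  have h := ((tendsto_ncard_progressionSet_invFactor hm hmp a).comp
    (tendsto_id.atTop_div_const hc)).const_mul c⁻¹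
  have e : c⁻¹ * (1 / m * Cconst) = 1 / (m * c) * Cconst := by
    rw [one_div, one_div, mul_inv]
    ring
  rw [e] at h
  refine h.congr fun x => ?_
  simp only [Function.comp, id]
  field_simp

lemma tendsto_card_mod_eq {k a : ℕ} (ha : a < 2 ^ k) {c : ℝ} (hc : 0 < c) :
    Tendsto (fun x : ℝ =>
      (Nat.card {D : ℕ // 0 < D ∧ D % 2 ^ k = a ∧ c * F D < x} : ℝ) / x) atTop
      (𝓝 (1 / (2 ^ k * c) * Cconst)) := by
  have h := tendsto_ncard_progressionSet_div (m := 2 ^ k) (by positivity)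
    (fun p hp hp2 => Nat.Coprime.pow_left k ((Nat.coprime_primes Nat.prime_two hp).2 hp2.symm))
    a hc
  push_cast at h
  refine h.congr fun x => ?_
  rw [← setOf_F_lt_eq_progressionSet ha hc]
  rfl

lemma tendsto_card_mod_ne {k a : ℕ} (ha : a < 2 ^ k) {c : ℝ} (hc : 0 < c) :
    Tendsto (fun x : ℝ =>
      (Nat.card {D : ℕ // 0 < D ∧ D % 2 ^ k ≠ a ∧ c * F D < x} : ℝ) / x) atTop
      (𝓝 (1 / c * Cconst - 1 / (2 ^ k * c) * Cconst)) := by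
  have h1 := tendsto_ncard_progressionSet_div (m := 1) one_pos
    (fun p _ _ => Nat.coprime_one_left p) 0 hc
  rw [Nat.cast_one, one_mul] at h1
  refine (h1.sub (tendsto_card_mod_eq ha hc)).congr fun x => ?_
  have hfin := finite_progressionSet_invFactor 1 0 (x / c)
  rw [← setOf_F_lt_eq_progressionSet one_pos hc] at hfin ⊢
  have hsub : {D : ℕ | 0 < D ∧ D % 2 ^ k = a ∧ c * F D < x} ⊆
      {D : ℕ | 0 < D ∧ D % 1 = 0 ∧ c * F D < x} :=
    fun D hD => ⟨hD.1, Nat.mod_one D, hD.2.2⟩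
  have hset : {D : ℕ | 0 < D ∧ D % 2 ^ k ≠ a ∧ c * F D < x} =
      {D : ℕ | 0 < D ∧ D % 1 = 0 ∧ c * F D < x} \
        {D : ℕ | 0 < D ∧ D % 2 ^ k = a ∧ c * F D < x} := by
    ext D
    simp only [Set.mem_sdiff, Set.mem_ofPred_eq, Nat.mod_one]
    tauto
  have hcard : (Nat.card {D : ℕ // 0 < D ∧ D % 2 ^ k ≠ a ∧ c * F D < x} : ℝ) =
      {D : ℕ | 0 < D ∧ D % 1 = 0 ∧ c * F D < x}.ncard -
        {D : ℕ | 0 < D ∧ D % 2 ^ k = a ∧ c * F D < x}.ncard := by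
    rw [← Nat.cast_sub (Set.ncard_le_ncard hsub hfin),
      ← Set.ncard_sdiff hsub (hfin.subset hsub), ← hset]
    rfl
  rw [hcard, sub_div]
  rfl

/-- The count Π(x) of primitive totally geodesic immersed surfaces of area < x in the
d = 2 Bianchi orbifold, expressed via the nine families of maximal Fuchsian subgroups
and their covolumes, satisfies Π(x)/x → (45/(16π))·C. -/
theorem stmt_19 :
    Filter.Tendsto
      (fun x : ℝ =>
        ((Nat.card {D : ℕ // 0 < D ∧ D % 8 = 0 ∧ π * F D < x} +
          Nat.card {D : ℕ // 0 < D ∧ D % 8 ≠ 0 ∧ 2 * π * F D < x} +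
          Nat.card {D : ℕ // 0 < D ∧ D % 8 = 1 ∧ π * F D < x} +
          Nat.card {D : ℕ // 0 < D ∧ D % 8 = 5 ∧ π / 3 * F D < x} +
          Nat.card {D : ℕ // 0 < D ∧ D % 16 = 2 ∧ π / 6 * F D < x} +
          Nat.card {D : ℕ // 0 < D ∧ D % 16 = 6 ∧ π / 6 * F D < x} +
          Nat.card {D : ℕ // 0 < D ∧ D % 4 = 2 ∧ π / 2 * F D < x} +
          Nat.card {D : ℕ // 0 < D ∧ D % 8 = 3 ∧ π * F D < x} +
          Nat.card {D : ℕ // 0 < D ∧ D % 8 = 7 ∧ π / 3 * F D < x} : ℕ) : ℝ) / x)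
      Filter.atTop (nhds (45 / (16 * π) * Cconst)) := by
  have h1 := tendsto_card_mod_eq (k := 3) (a := 0) (by norm_num) pi_pos
  have h2 := tendsto_card_mod_ne (k := 3) (a := 0) (by norm_num) two_pi_pos
  have h3 := tendsto_card_mod_eq (k := 3) (a := 1) (by norm_num) pi_pos
  have h4 := tendsto_card_mod_eq (k := 3) (a := 5) (by norm_num) (div_pos pi_pos three_pos)
  have h5 := tendsto_card_mod_eq (k := 4) (a := 2) (by norm_num)
    (div_pos pi_pos (by norm_num : (0 : ℝ) < 6))
  have h6 := tendsto_card_mod_eq (k := 4) (a := 6) (by norm_num)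
    (div_pos pi_pos (by norm_num : (0 : ℝ) < 6))
  have h7 := tendsto_card_mod_eq (k := 2) (a := 2) (by norm_num) (div_pos pi_pos two_pos)
  have h8 := tendsto_card_mod_eq (k := 3) (a := 3) (by norm_num) pi_pos
  have h9 := tendsto_card_mod_eq (k := 3) (a := 7) (by norm_num) (div_pos pi_pos three_pos)
  have h := (((((((h1.add h2).add h3).add h4).add h5).add h6).add h7).add h8).add h9
  have hπ := pi_ne_zero
  convert h using 2
  · push_cast
    simp only [add_div]
  · field_simp
    ring
end
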